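/- arXiv:1806.04333 — 4 statements merged into one kernel-verified Lean document; each statement's English description precedes it below -/
import Mathlib

section
/- Fix m, n ∈ ℕ, p ∈ (0,2), λ ∈ (0,∞), and a finitely supported isotropic measure μ = ∑_{j=1}^M c_j δ_{u_j} on S^{m−1} with u_j ∈ S^{m−1} and c_j ∈ (0,∞). Let X = X_p(μ). Then there exists a Borel probability measure ν on (0,∞)^M such that for every (x_1,…,x_n) ∈ (ℝ^m)^n: exp(−∑_{i=1}^n (λ‖x_i‖_X^p + ½‖x_i‖_2²)) = ∫_{(0,∞)^{nM}} exp(−∑_{i=1}^n ∑_{j=1}^M s_{ij} ⟨x_i,u_j⟩²) dν_n(s), where ν_n = ν^{⊗n}. -/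
open MeasureTheory Real
open scoped ENNReal

noncomputable section

open Filter Topology Set

/-- Pointwise limits of moment functions of probability measures on the unit interval are moment
functions. -/
lemma exists_measure_moment_eq_of_tendsto (P : ℕ → ProbabilityMeasure unitInterval) (f : ℝ → ℝ)
    (hf : ∀ t, 0 < t → Tendsto (fun n => ∫ z, (z : ℝ) ^ t ∂(P n : Measure unitInterval)) atTop
      (𝓝 (f t))) :
    ∃ Q : ProbabilityMeasure unitInterval,
      ∀ t, 0 < t → ∫ z, (z : ℝ) ^ t ∂(Q : Measure unitInterval) = f t := by
  let U : Ultrafilter ℕ := Ultrafilter.of atTop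
  have hU : (U : Filter ℕ) ≤ atTop := Ultrafilter.of_le atTop
  obtain ⟨Q, hQ⟩ : ∃ Q, Tendsto P U (𝓝 Q) :=
    ⟨(U.map P).lim, (U.map P).le_nhds_lim⟩
  refine ⟨Q, fun t ht => ?_⟩
  have hcont : Continuous fun z : unitInterval => (z : ℝ) ^ t :=
    (Real.continuous_rpow_const ht.le).comp continuous_subtype_val
  exact tendsto_nhds_unique
    (ProbabilityMeasure.tendsto_iff_forall_integral_tendsto.1 hQ
      (BoundedContinuousFunction.mkOfCompact ⟨_, hcont⟩)) ((hf t ht).mono_left hU)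

/-- The integrand of the Lévy–Khintchine formula of the `α`-stable subordinator. -/
lemma integrableOn_one_sub_exp_mul_rpow {α t : ℝ} (h0 : 0 < α) (h1 : α < 1) (ht : 0 < t) :
    IntegrableOn (fun s : ℝ => (1 - exp (-(t * s))) * s ^ (-(α + 1))) (Ioi 0) := by
  have hmeas : Measurable fun s : ℝ => (1 - exp (-(t * s))) * s ^ (-(α + 1)) := by fun_prop
  rw [← Ioc_union_Ioi_eq_Ioi zero_le_one]
  refine IntegrableOn.union ?_ ?_
  · have hi : IntegrableOn (fun s : ℝ => t * s ^ (-α)) (Ioc 0 1) :=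
      ((intervalIntegral.intervalIntegrable_rpow' (by linarith : -1 < -α)).1).const_mul t
    refine hi.mono' hmeas.aestronglyMeasurable ?_
    filter_upwards [ae_restrict_mem measurableSet_Ioc] with s hs
    have hs0 := hs.1
    have e1 : 0 ≤ 1 - exp (-(t * s)) := by
      have : 0 < t * s := by positivity
      simp [this.le]
    have e2 : 1 - exp (-(t * s)) ≤ t * s := by linarith [add_one_le_exp (-(t * s))]
    have e3 : s ^ (-α) = s * s ^ (-(α + 1)) := by
      rw [← rpow_one_add' hs0.le (by linarith)]; ring_nf
    rw [norm_mul, norm_of_nonneg e1, norm_of_nonneg (by positivity), e3, ← mul_assoc]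
    gcongr
  · have hi : IntegrableOn (fun s : ℝ => s ^ (-(α + 1))) (Ioi 1) :=
      integrableOn_Ioi_rpow_of_lt (by linarith) zero_lt_one
    refine hi.mono' hmeas.aestronglyMeasurable ?_
    filter_upwards [ae_restrict_mem measurableSet_Ioi] with s hs
    have hs0 : 0 < s := zero_lt_one.trans hs
    have e1 : 0 ≤ 1 - exp (-(t * s)) := by
      have : 0 < t * s := by positivity
      simp [this.le]
    have e2 : 1 - exp (-(t * s)) ≤ 1 := by linarith [exp_pos (-(t * s))]
    rw [norm_mul, norm_of_nonneg e1, norm_of_nonneg (by positivity)]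
    exact mul_le_of_le_one_left (by positivity) e2

/-- Scaling of the Lévy–Khintchine integral of the `α`-stable subordinator. -/
lemma integral_one_sub_exp_mul_rpow {α t : ℝ} (ht : 0 < t) :
    ∫ s in Ioi (0 : ℝ), (1 - exp (-(t * s))) * s ^ (-(α + 1)) =
      t ^ α * ∫ s in Ioi (0 : ℝ), (1 - exp (-s)) * s ^ (-(α + 1)) := by
  have h := integral_comp_mul_left_Ioi (fun s : ℝ => (1 - exp (-s)) * s ^ (-(α + 1))) 0 ht
  rw [mul_zero, smul_eq_mul] at h
  have h2 : ∫ s in Ioi (0 : ℝ), (1 - exp (-(t * s))) * (t * s) ^ (-(α + 1)) =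
      t ^ (-(α + 1)) * ∫ s in Ioi (0 : ℝ), (1 - exp (-(t * s))) * s ^ (-(α + 1)) := by
    rw [← integral_const_mul]
    refine setIntegral_congr_fun measurableSet_Ioi fun s hs => ?_
    simp only [mul_rpow ht.le (le_of_lt hs)]
    ring
  rw [h2] at h
  have h3 : t ^ α * t⁻¹⁻¹ * t ^ (-(α + 1)) = 1 := by
    rw [inv_inv, ← rpow_add_one ht.ne', ← rpow_add ht]; simp
  have ht' : t ^ α * t * t ^ (-(α + 1)) = 1 := by simpa using h3
  calc _ = t ^ α * t * (t ^ (-(α + 1)) *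
        ∫ s in Ioi (0 : ℝ), (1 - exp (-(t * s))) * s ^ (-(α + 1))) := by
        rw [← mul_assoc, ht', one_mul]
    _ = _ := by rw [h]; field_simp

lemma integral_one_sub_exp_mul_rpow_pos {α : ℝ} (h0 : 0 < α) (h1 : α < 1) :
    0 < ∫ s in Ioi (0 : ℝ), (1 - exp (-s)) * s ^ (-(α + 1)) := by
  have hpos : ∀ s ∈ Ioi (0 : ℝ), 0 < (1 - exp (-s)) * s ^ (-(α + 1)) := fun s hs => by
    have hs : 0 < s := hs
    have : 0 < 1 - exp (-s) := by simp [hs]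
    positivity
  have hi := integrableOn_one_sub_exp_mul_rpow h0 h1 zero_lt_one
  simp only [one_mul] at hi
  rw [setIntegral_pos_iff_support_of_nonneg_ae _ hi]
  · have : Ioi (0 : ℝ) ⊆ Function.support (fun s : ℝ => (1 - exp (-s)) * s ^ (-(α + 1))) :=
      fun s hs => (hpos s hs).ne'
    rw [inter_eq_right.2 this]
    simp
  · filter_upwards [ae_restrict_mem measurableSet_Ioi] with s hs using (hpos s hs).le

lemma one_sub_integral_exp_paretoMeasure {α t ε : ℝ} (h0 : 0 < α) (ht : 0 < t) (hε : 0 < ε) :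
    1 - ∫ s, exp (-(t * max s 0)) ∂(ProbabilityTheory.paretoMeasure ε α) =
      α * ε ^ α * ∫ s in Ioi ε, (1 - exp (-(t * s))) * s ^ (-(α + 1)) := by
  have := ProbabilityTheory.isProbabilityMeasure_paretoMeasure hε h0
  have hint : Integrable (fun s : ℝ => exp (-(t * max s 0)))
      (ProbabilityTheory.paretoMeasure ε α) := by
    refine Integrable.of_bound (C := 1) (by fun_prop) (ae_of_all _ fun s => ?_)
    have : 0 ≤ t * max s 0 := by positivity
    simpa [abs_of_pos (exp_pos _)] using this
  have h : 1 - ∫ s, exp (-(t * max s 0)) ∂(ProbabilityTheory.paretoMeasure ε α) =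
      ∫ s, (1 - exp (-(t * max s 0))) ∂(ProbabilityTheory.paretoMeasure ε α) := by
    rw [integral_sub (integrable_const _) hint]; simp
  have hpdf : Measurable (ProbabilityTheory.paretoPDF ε α) :=
    ENNReal.measurable_ofReal.comp (ProbabilityTheory.measurable_paretoPDFReal ε α)
  rw [h, ProbabilityTheory.paretoMeasure,
    integral_withDensity_eq_integral_toReal_smul hpdf
      (ae_of_all _ fun _ => ENNReal.ofReal_lt_top),
    ← integral_const_mul, ← integral_Ici_eq_integral_Ioi,
    ← integral_indicator measurableSet_Ici]
  congr 1 with s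
  rw [ProbabilityTheory.paretoPDF,
    ENNReal.toReal_ofReal (ProbabilityTheory.paretoPDFReal_nonneg hε.le h0.le s),
    ProbabilityTheory.paretoPDFReal]
  by_cases hs : ε ≤ s
  · have : max s 0 = s := max_eq_left (hε.le.trans hs)
    simp [hs, this]; ring
  · simp [hs]

lemma tendsto_mul_one_sub_integral_exp_paretoMeasure {α t b : ℝ} (h0 : 0 < α) (h1 : α < 1)
    (ht : 0 < t) (hb : 0 < b) :
    Tendsto (fun n : ℕ => (n : ℝ) * (∫ s, exp (-(t * max s 0))
        ∂(ProbabilityTheory.paretoMeasure ((b / (n + 1)) ^ α⁻¹) α) - 1)) atTop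
      (𝓝 (-(b * α * (∫ s in Ioi (0 : ℝ), (1 - exp (-s)) * s ^ (-(α + 1))) * t ^ α))) := by
  have hε : Tendsto (fun n : ℕ => (b / ((n : ℝ) + 1)) ^ α⁻¹) atTop (𝓝 0) := by
    have h2 : Tendsto (fun n : ℕ => b / ((n : ℝ) + 1)) atTop (𝓝 0) := by
      simpa [div_eq_mul_inv] using (tendsto_one_div_add_atTop_nhds_zero_nat (𝕜 := ℝ)).const_mul b
    have := h2.rpow_const (p := α⁻¹) (Or.inr (by positivity))
    rwa [zero_rpow (by positivity)] at this
  have hI := (aecover_Ioi_of_Ioi hε).integral_tendsto_of_countably_generated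
    (integrableOn_one_sub_exp_mul_rpow h0 h1 ht)
  have hn : Tendsto (fun n : ℕ => (n : ℝ) / (n + 1)) atTop (𝓝 1) :=
    tendsto_natCast_div_add_atTop 1
  have key := ((hn.mul_const (b * α)).mul hI).neg
  rw [integral_one_sub_exp_mul_rpow ht] at key
  refine (key.congr fun n => ?_).trans (le_of_eq ?_)
  · have hpos : 0 < b / ((n : ℝ) + 1) := by positivity
    have he := one_sub_integral_exp_paretoMeasure h0 ht (rpow_pos_of_pos hpos α⁻¹)
    rw [← neg_sub 1, he, rpow_inv_rpow hpos.le h0.ne',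
      Measure.restrict_restrict measurableSet_Ioi, Ioi_inter_Ioi,
      sup_of_le_left (rpow_nonneg hpos.le _)]
    ring
  · congr 1; ring

/-- The law of `exp (-∑ max Xᵢ 0)` for `n` independent Pareto variables `Xᵢ`. -/
lemma exists_measure_moment_eq_pow (n : ℕ) (ρ : Measure ℝ) [IsProbabilityMeasure ρ] :
    ∃ P : ProbabilityMeasure unitInterval, ∀ t,
      ∫ z, (z : ℝ) ^ t ∂(P : Measure unitInterval) = (∫ s, exp (-(t * max s 0)) ∂ρ) ^ n := by
  let φ : (Fin n → ℝ) → unitInterval := fun s => ⟨exp (-∑ i, max (s i) 0), (exp_pos _).le, by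
    have : 0 ≤ ∑ i, max (s i) 0 := Finset.sum_nonneg fun i _ => le_max_right _ _
    simpa using this⟩
  have hφ : Measurable φ := Measurable.subtype_mk (by fun_prop)
  refine ⟨⟨(Measure.pi fun _ : Fin n => ρ).map φ, Measure.isProbabilityMeasure_map hφ.aemeasurable⟩,
    fun t => ?_⟩
  have hm : Measurable fun z : unitInterval => (z : ℝ) ^ t := by fun_prop
  rw [ProbabilityMeasure.coe_mk, integral_map hφ.aemeasurable hm.aestronglyMeasurable]
  have := integral_fintype_prod_eq_pow (ι := Fin n) (fun s : ℝ => exp (-(t * max s 0))) (μ := ρ)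
  rw [Fintype.card_fin] at this
  rw [← this]
  congr 1 with s
  simp only [φ]
  rw [← exp_sum, ← exp_mul, Finset.sum_neg_distrib, ← Finset.mul_sum]
  ring_nf

/-- Existence of the positive `α`-stable law. -/
lemma exists_measure_laplace_eq_exp_neg_rpow {α a : ℝ} (h0 : 0 < α) (h1 : α < 1) (ha : 0 < a) :
    ∃ τ : Measure ℝ, IsProbabilityMeasure τ ∧ τ (Iio 0) = 0 ∧
      ∀ t, 0 ≤ t → ∫ s, exp (-(s * t)) ∂τ = exp (-(a * t ^ α)) := by
  have hC := integral_one_sub_exp_mul_rpow_pos h0 h1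
  set C := ∫ s in Ioi (0 : ℝ), (1 - exp (-s)) * s ^ (-(α + 1)) with hCdef
  let b : ℝ := a / (α * C)
  have hb : 0 < b := by positivity
  have hε (n : ℕ) : 0 < (b / ((n : ℝ) + 1)) ^ α⁻¹ := by positivity
  have hprob (n : ℕ) := ProbabilityTheory.isProbabilityMeasure_paretoMeasure (hε n) h0
  choose P hP using fun n : ℕ => exists_measure_moment_eq_pow n
    (ProbabilityTheory.paretoMeasure ((b / ((n : ℝ) + 1)) ^ α⁻¹) α)
  obtain ⟨Q, hQ⟩ := exists_measure_moment_eq_of_tendsto P (fun t => exp (-(a * t ^ α)))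
    fun t ht => by
      have h := Real.tendsto_one_add_pow_exp_of_tendsto
        (tendsto_mul_one_sub_integral_exp_paretoMeasure h0 h1 ht hb)
      have hbC : b * α * C = a := by simp only [b]; field_simp
      rw [← hCdef, hbC] at h
      refine h.congr fun n => ?_
      rw [hP, add_sub_cancel]
  have hreal : (Q : Measure unitInterval).real {0}ᶜ = 1 := by
    refine le_antisymm measureReal_le_one ?_
    have hlim : Tendsto (fun t : ℝ => exp (-(a * t ^ α))) (𝓝[>] 0) (𝓝 1) := by
      have : Tendsto (fun t : ℝ => exp (-(a * t ^ α))) (𝓝 0) (𝓝 (exp (-(a * 0 ^ α)))) :=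
        ((((Real.continuous_rpow_const h0.le).tendsto 0).const_mul a).neg).rexp
      rw [zero_rpow h0.ne', mul_zero, neg_zero, exp_zero] at this
      exact this.mono_left nhdsWithin_le_nhds
    refine le_of_tendsto hlim ?_
    filter_upwards [self_mem_nhdsWithin] with t ht
    rw [← hQ t ht, ← integral_indicator_one (measurableSet_singleton _).compl]
    have hle : ∀ z : unitInterval, (z : ℝ) ^ t ≤ ({0}ᶜ : Set unitInterval).indicator 1 z := by
      intro z
      by_cases hz : z = 0
      · simp [hz, zero_rpow (ne_of_gt ht)]
      · simpa [hz] using rpow_le_one z.2.1 z.2.2 (le_of_lt ht)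
    refine integral_mono_of_nonneg (ae_of_all _ fun z => rpow_nonneg z.2.1 t)
      ((integrable_const (1 : ℝ)).indicator (measurableSet_singleton _).compl) (ae_of_all _ hle)
  have hQ0 : ∀ᵐ z ∂(Q : Measure unitInterval), z ≠ 0 := by
    have := (prob_compl_eq_zero_iff (μ := (Q : Measure unitInterval))
      (measurableSet_singleton (0 : unitInterval)).compl).2
      (by rwa [measureReal_def, ENNReal.toReal_eq_one_iff] at hreal)
    exact this
  have hlog : Measurable fun z : unitInterval => -log (z : ℝ) := by fun_prop
  refine ⟨(Q : Measure unitInterval).map fun z : unitInterval => -log (z : ℝ),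
    Measure.isProbabilityMeasure_map hlog.aemeasurable, ?_, fun t ht => ?_⟩
  · rw [Measure.map_apply hlog measurableSet_Iio]
    convert measure_empty (μ := (Q : Measure unitInterval))
    ext z
    simpa using log_nonpos z.2.1 z.2.2
  · rcases ht.eq_or_lt with rfl | ht
    · have := Measure.isProbabilityMeasure_map (μ := (Q : Measure unitInterval)) hlog.aemeasurable
      simp [zero_rpow h0.ne']
    · rw [integral_map hlog.aemeasurable (by fun_prop), ← hQ t ht]
      refine integral_congr_ae ?_
      filter_upwards [hQ0] with z hz
      have hz : 0 < (z : ℝ) := unitInterval.pos_iff_ne_zero.2 hz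
      rw [rpow_def_of_pos hz]
      simp

/-- **Lemma (Gaussian mixture representation of the density).** Let `p ∈ (0,2)`, `λ > 0` and
let `μ = ∑_{j=1}^M c_j δ_{u_j}` be a finitely supported isotropic measure on `S^{m-1}`, so
that `X = X_p(μ)` has `‖x‖_X^p = ∑_j c_j |⟨x,u_j⟩|^p` and `‖x‖₂² = ∑_j c_j ⟨x,u_j⟩²`. Then
there is a Borel probability measure `ν` on `(0,∞)^M` such that for all
`(x_1,…,x_n) ∈ (ℝ^m)^n`,
`exp(−∑_i (λ‖x_i‖_X^p + ½‖x_i‖₂²)) = ∫ exp(−∑_i ∑_j s_{ij} ⟨x_i,u_j⟩²) dν^{⊗n}(s)`. -/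
theorem gaussian_mixture_representation (m n M : ℕ) (p : ℝ) (hp0 : 0 < p) (hp2 : p < 2)
    (lam : ℝ) (hlam : 0 < lam)
    (c : Fin M → ℝ) (hc : ∀ j, 0 < c j)
    (u : Fin M → Fin m → ℝ) (hu : ∀ j, ∑ k, u j k ^ 2 = 1)
    (hiso : ∀ x : Fin m → ℝ, ∑ k, x k ^ 2 = ∑ j, c j * (∑ k, x k * u j k) ^ 2) :
    ∃ ν : Measure (Fin M → ℝ), IsProbabilityMeasure ν ∧
      ν {s | ¬ ∀ j, 0 < s j} = 0 ∧
      ∀ x : Fin n → Fin m → ℝ,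
        Real.exp (-(∑ i : Fin n,
            (lam * ∑ j, c j * |∑ k, x i k * u j k| ^ p + (∑ k, x i k ^ 2) / 2))) =
          ∫ s, Real.exp (-(∑ i : Fin n, ∑ j, s i j * (∑ k, x i k * u j k) ^ 2))
            ∂(Measure.pi fun _ : Fin n => ν) := by
  choose τ hτprob hτ0 hτ using fun j => exists_measure_laplace_eq_exp_neg_rpow
    (half_pos hp0) (by linarith : p / 2 < 1) (mul_pos hlam (hc j))
  have hmeas (j : Fin M) : Measurable fun s : ℝ => s + c j / 2 := by fun_prop
  let σ : Fin M → Measure ℝ := fun j => (τ j).map fun s => s + c j / 2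
  have hσ (j) : IsProbabilityMeasure (σ j) :=
    Measure.isProbabilityMeasure_map (hmeas j).aemeasurable
  have hσpos (j) : ∀ᵐ s ∂σ j, 0 < s := by
    refine (ae_map_iff (hmeas j).aemeasurable measurableSet_Ioi).2 ?_
    have h : ∀ᵐ s ∂τ j, s ∉ Iio (0 : ℝ) := measure_eq_zero_iff_ae_notMem.1 (hτ0 j)
    filter_upwards [h] with s hs
    have := hc j
    simp only [mem_Iio, not_lt] at hs
    positivity
  have hσlap (j) (y : ℝ) : ∫ s, exp (-(s * y ^ 2)) ∂σ j =
      exp (-(lam * (c j * |y| ^ p) + c j * y ^ 2 / 2)) := by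
    have hpow : (y ^ 2) ^ (p / 2) = |y| ^ p := by
      rw [← sq_abs, ← rpow_natCast, ← rpow_mul (abs_nonneg y)]
      congr 1; push_cast; ring
    have h := hτ j (y ^ 2) (sq_nonneg y)
    rw [hpow] at h
    rw [integral_map (hmeas j).aemeasurable (by fun_prop)]
    have hsplit (s : ℝ) : exp (-((s + c j / 2) * y ^ 2)) =
        exp (-(s * y ^ 2)) * exp (-(c j * y ^ 2 / 2)) := by
      rw [← exp_add]; ring_nf
    simp_rw [hsplit]
    rw [integral_mul_const, h, ← exp_add]
    ring_nf
  refine ⟨Measure.pi σ, inferInstance, ?_, fun x => ?_⟩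
  · have h : ∀ᵐ s ∂Measure.pi σ, ∀ j, 0 < s j :=
      ae_all_iff.2 fun j => (Measure.quasiMeasurePreserving_eval σ j).ae (hσpos j)
    exact h
  · simp_rw [← Finset.sum_neg_distrib, exp_sum]
    rw [integral_fintype_prod_eq_prod
      (f := fun (i : Fin n) (s : Fin M → ℝ) => ∏ j, exp (-(s j * (∑ k, x i k * u j k) ^ 2)))]
    refine Finset.prod_congr rfl fun i _ => ?_
    rw [integral_fintype_prod_eq_prod
      (f := fun (j : Fin M) (s : ℝ) => exp (-(s * (∑ k, x i k * u j k) ^ 2)))]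
    simp_rw [hσlap]
    rw [← exp_sum, hiso, Finset.sum_neg_distrib, Finset.sum_add_distrib, Finset.mul_sum,
      Finset.sum_div]
end
end

section
/- Fix m ∈ ℕ and r ∈ (0,∞). For every pair of positive definite symmetric m×m real matrices A, B and every λ ∈ (0,1): det(λA + (1−λ)B)^{−r} ≤ λ·det(A)^{−r} + (1−λ)·det(B)^{−r}. Equivalently, the function A ↦ det(A)^{−r} is convex on the cone of positive definite matrices. -/
open Real

noncomputable section

namespace Matrix

variable {n : Type*} [Fintype n] [DecidableEq n]

open scoped MatrixOrder Matrix.Norms.L2Operator in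
/-- A real positive definite matrix factors as `Sᴴ * S` with `S` invertible. -/
theorem PosDef.exists_isUnit_eq_star_mul_self {B : Matrix n n ℝ} (hB : B.PosDef) :
    ∃ S : Matrix n n ℝ, IsUnit S ∧ B = star S * S :=
  CStarAlgebra.isStrictlyPositive_iff_eq_star_mul_self.mp hB.isStrictlyPositive

theorem IsHermitian.det_smul_add_smul_one {C : Matrix n n ℝ} (hC : C.IsHermitian) (a b : ℝ) :
    (a • C + b • (1 : Matrix n n ℝ)).det = ∏ i, (a * hC.eigenvalues i + b) := by
  set φ := Unitary.conjStarAlgAut ℝ _ hC.eigenvectorUnitary with hφ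
  have key : a • C + b • (1 : Matrix n n ℝ) =
      φ (diagonal fun i ↦ a * hC.eigenvalues i + b) := by
    have hdiag : (diagonal fun i ↦ a * hC.eigenvalues i + b) =
        a • diagonal (RCLike.ofReal ∘ hC.eigenvalues) + b • (1 : Matrix n n ℝ) := by
      ext i j
      by_cases h : i = j <;> simp [h]
    rw [hdiag, map_add, map_smul, map_smul, map_one, hφ, ← hC.spectral_theorem]
  rw [key, hφ, Unitary.conjStarAlgAut_apply, det_mul_comm, ← mul_assoc]
  simp

theorem PosDef.det_rpow_le_det_smul_add_smul_one {C : Matrix n n ℝ} (hC : C.PosDef) {a b : ℝ}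
    (ha : 0 ≤ a) (hb : 0 ≤ b) (hab : a + b = 1) :
    C.det ^ a ≤ (a • C + b • (1 : Matrix n n ℝ)).det := by
  rw [hC.isHermitian.det_smul_add_smul_one, hC.isHermitian.det_eq_prod_eigenvalues]
  have hpos := hC.eigenvalues_pos
  simp only [RCLike.ofReal_real_eq_id, id]
  rw [← Real.finsetProd_rpow _ _ fun i _ ↦ (hpos i).le]
  refine Finset.prod_le_prod (fun i _ ↦ Real.rpow_nonneg (hpos i).le a) fun i _ ↦ ?_
  simpa using Real.geom_mean_le_arith_mean2_weighted ha hb (hpos i).le zero_le_one hab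

/-- The determinant is log-concave on positive definite matrices. -/
theorem PosDef.det_rpow_mul_det_rpow_le_det {A B : Matrix n n ℝ} (hA : A.PosDef) (hB : B.PosDef)
    {a b : ℝ} (ha : 0 ≤ a) (hb : 0 ≤ b) (hab : a + b = 1) :
    A.det ^ a * B.det ^ b ≤ (a • A + b • B).det := by
  obtain ⟨S, hS, rfl⟩ := hB.exists_isUnit_eq_star_mul_self
  obtain ⟨C, rfl⟩ : ∃ C, A = star S * C * S := by
    obtain ⟨U, rfl⟩ := hS
    refine ⟨star (↑U⁻¹ : Matrix n n ℝ) * A * (↑U⁻¹ : Matrix n n ℝ), ?_⟩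
    rw [← mul_assoc, ← mul_assoc, ← star_mul, Units.inv_mul, star_one, one_mul, mul_assoc,
      Units.inv_mul, mul_one]
  have hC : C.PosDef := (IsUnit.posDef_star_left_conjugate_iff hS).mp hA
  have hsum : a • (star S * C * S) + b • (star S * S) =
      star S * (a • C + b • (1 : Matrix n n ℝ)) * S := by
    simp [mul_add, add_mul]
  have hd : 0 < (star S).det * S.det := by simpa only [det_mul] using hB.det_pos
  have hsplit (M : Matrix n n ℝ) :
      (star S * M * S).det = M.det * ((star S).det * S.det) := by
    rw [det_mul, det_mul]
    ring
  rw [hsum, hsplit, hsplit, det_mul, Real.mul_rpow hC.det_pos.le hd.le, mul_assoc,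
    ← Real.rpow_add hd, hab, Real.rpow_one]
  exact mul_le_mul_of_nonneg_right (hC.det_rpow_le_det_smul_add_smul_one ha hb hab) hd.le

end Matrix

/-- **Convexity of `A ↦ det(A)^{-r}` on positive definite matrices.** For every `r > 0`,
positive definite symmetric `m×m` real matrices `A, B` and `λ ∈ (0,1)`,
`det(λA + (1−λ)B)^{-r} ≤ λ det(A)^{-r} + (1−λ) det(B)^{-r}`. -/
theorem det_inverse_power_convex (m : ℕ) (r : ℝ) (hr : 0 < r)
    (A B : Matrix (Fin m) (Fin m) ℝ) (hA : A.PosDef) (hB : B.PosDef)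
    (l : ℝ) (hl0 : 0 < l) (hl1 : l < 1) :
    (l • A + (1 - l) • B).det ^ (-r) ≤ l * A.det ^ (-r) + (1 - l) * B.det ^ (-r) := by
  have hl1' : 0 ≤ 1 - l := by linarith
  have hab : l + (1 - l) = 1 := by ring
  have hdA := hA.det_pos
  have hdB := hB.det_pos
  calc (l • A + (1 - l) • B).det ^ (-r)
      ≤ (A.det ^ l * B.det ^ (1 - l)) ^ (-r) :=
        Real.rpow_le_rpow_of_nonpos (by positivity)
          (hA.det_rpow_mul_det_rpow_le_det hB hl0.le hl1' hab) (by linarith)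
    _ = (A.det ^ (-r)) ^ l * (B.det ^ (-r)) ^ (1 - l) := by
        rw [Real.mul_rpow (by positivity) (by positivity), ← Real.rpow_mul hdA.le,
          ← Real.rpow_mul hdB.le, mul_comm l, mul_comm (1 - l), Real.rpow_mul hdA.le,
          Real.rpow_mul hdB.le]
    _ ≤ l * A.det ^ (-r) + (1 - l) * B.det ^ (-r) :=
        Real.geom_mean_le_arith_mean2_weighted hl0.le hl1' (by positivity) (by positivity) hab
end
end

section
/- For every β ∈ (0,1] and c ∈ (0,∞), the function h : (0,∞) → ℝ given by h(t) = exp(−c t^β) is completely monotonic, i.e. h is infinitely differentiable on (0,∞) and (−1)^k h^{(k)}(t) ≥ 0 for every t ∈ (0,∞) and every integer k ≥ 0. -/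
open Real Set

noncomputable section

theorem contDiffOn_rpow_mul_exp_neg_rpow (β c p : ℝ) {n : WithTop ℕ∞} :
    ContDiffOn ℝ n (fun t : ℝ => t ^ p * Real.exp (-(c * t ^ β))) (Ioi 0) := by
  have hrpow (q : ℝ) : ContDiffOn ℝ n (fun t : ℝ => t ^ q) (Ioi 0) :=
    fun t ht => (Real.contDiffAt_rpow_const_of_ne (ne_of_gt ht)).contDiffWithinAt
  exact (hrpow p).mul (contDiffOn_const.mul (hrpow β)).neg.exp

theorem derivWithin_rpow_mul_exp_neg_rpow (β c p : ℝ) {t : ℝ} (ht : t ∈ Ioi (0 : ℝ)) :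
    derivWithin (fun t : ℝ => t ^ p * Real.exp (-(c * t ^ β))) (Ioi 0) t =
      p * (t ^ (p - 1) * Real.exp (-(c * t ^ β))) +
        -(c * β) * (t ^ (p + β - 1) * Real.exp (-(c * t ^ β))) := by
  have ht' : 0 < t := ht
  have h : HasDerivAt (fun t : ℝ => t ^ p * Real.exp (-(c * t ^ β))) _ t :=
    (Real.hasDerivAt_rpow_const (p := p) (Or.inl ht'.ne')).mul
      ((Real.hasDerivAt_rpow_const (p := β) (Or.inl ht'.ne')).const_mul c).neg.exp
  rw [derivWithin_of_isOpen isOpen_Ioi ht, h.deriv, add_sub_assoc, Real.rpow_add ht', Pi.neg_apply]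
  ring

theorem neg_one_pow_mul_iteratedDerivWithin_rpow_mul_exp_neg_rpow_nonneg {β c : ℝ}
    (hβ0 : 0 ≤ β) (hβ1 : β ≤ 1) (hc : 0 ≤ c) (k : ℕ) {p : ℝ} (hp : p ≤ 0) {t : ℝ}
    (ht : t ∈ Ioi (0 : ℝ)) :
    0 ≤ (-1 : ℝ) ^ k *
      iteratedDerivWithin k (fun t : ℝ => t ^ p * Real.exp (-(c * t ^ β))) (Ioi 0) t := by
  induction k generalizing p with
  | zero =>
    have ht' : 0 < t := ht
    simp only [pow_zero, one_mul, iteratedDerivWithin_zero]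
    positivity
  | succ k ih =>
    have hs := uniqueDiffOn_Ioi (0 : ℝ)
    have hsmooth (q : ℝ) := contDiffOn_rpow_mul_exp_neg_rpow β c q (n := k) t ht
    rw [iteratedDerivWithin_succ',
      iteratedDerivWithin_congr (fun x hx => derivWithin_rpow_mul_exp_neg_rpow β c p hx) ht,
      iteratedDerivWithin_fun_add ht hs (contDiffWithinAt_const.mul (hsmooth _))
        (contDiffWithinAt_const.mul (hsmooth _)),
      iteratedDerivWithin_const_mul ht hs _ (hsmooth _),
      iteratedDerivWithin_const_mul ht hs _ (hsmooth _), pow_succ]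
    have h₁ := mul_nonneg (neg_nonneg.2 hp) (ih (p := p - 1) (by linarith))
    have h₂ := mul_nonneg (mul_nonneg hc hβ0) (ih (p := p + β - 1) (by linarith))
    linarith


/-- **Complete monotonicity of `t ↦ exp(−c t^β)`.** For every `β ∈ (0,1]` and `c > 0`, the
function `h(t) = exp(−c t^β)` is completely monotonic on `(0,∞)`: it is infinitely
differentiable there and `(−1)^k h^{(k)}(t) ≥ 0` for all `t > 0` and all `k ≥ 0`. -/
theorem exp_neg_rpow_completely_monotone (β c : ℝ) (hβ0 : 0 < β) (hβ1 : β ≤ 1) (hc : 0 < c) :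
    ContDiffOn ℝ (⊤ : ℕ∞) (fun t : ℝ => Real.exp (-(c * t ^ β))) (Ioi 0) ∧
      ∀ (k : ℕ), ∀ t ∈ Ioi (0 : ℝ),
        0 ≤ (-1 : ℝ) ^ k *
          iteratedDerivWithin k (fun t : ℝ => Real.exp (-(c * t ^ β))) (Ioi 0) t := by
  have h : (fun t : ℝ => Real.exp (-(c * t ^ β))) =
      fun t : ℝ => t ^ (0 : ℝ) * Real.exp (-(c * t ^ β)) := by
    simp
  rw [h]
  exact ⟨contDiffOn_rpow_mul_exp_neg_rpow β c 0, fun k _ ht =>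
    neg_one_pow_mul_iteratedDerivWithin_rpow_mul_exp_neg_rpow_nonneg hβ0.le hβ1 hc.le k le_rfl ht⟩
end
end

section
/- Fix n ∈ ℕ and d ∈ {1,…,n}. For every 1-symmetric convex body K ⊆ ℝ^n and every d-dimensional linear subspace F of ℝ^n, the d-dimensional Lebesgue measure of the orthogonal projection of K onto F satisfies |Proj_F K| ≥ |K|^{d/n}, where |K| is the n-dimensional Lebesgue measure of K. -/
open MeasureTheory Real
open scoped ENNReal

noncomputable section

/-- `K ⊆ ℝ^n` is 1-symmetric: membership is invariant under all sign changes and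
permutations of the coordinates. -/
def IsOneSymmetric (n : ℕ) (K : Set (Fin n → ℝ)) : Prop :=
  ∀ ε : Fin n → ℝ, (∀ i, ε i = 1 ∨ ε i = -1) → ∀ σ : Equiv.Perm (Fin n),
    ∀ x : Fin n → ℝ, x ∈ K ↔ (fun i => ε i * x (σ i)) ∈ K

section

open Filter Topology Set

set_option linter.unusedSectionVars false

section Gaussian

variable {E : Type*} [NormedAddCommGroup E] [InnerProductSpace ℝ E] [FiniteDimensional ℝ E]
  [MeasurableSpace E] [BorelSpace E]

/-- Density of the centered Gaussian measure with covariance `v • 1`. -/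
def isoGaussianDensity (E : Type*) [NormedAddCommGroup E] [InnerProductSpace ℝ E] (v : ℝ) (x : E) :
    ℝ :=
  (2 * π * v) ^ (-(Module.finrank ℝ E / 2 : ℝ)) * exp (-(1 / (2 * v)) * ‖x‖ ^ 2)

/-- The centered Gaussian measure with covariance `v • 1`. -/
def isoGaussian (E : Type*) [NormedAddCommGroup E] [InnerProductSpace ℝ E] [FiniteDimensional ℝ E]
    [MeasurableSpace E] [BorelSpace E] (v : ℝ) : Measure E :=
  volume.withDensity fun x => ENNReal.ofReal (isoGaussianDensity E v x)

lemma isoGaussianDensity_pos {v : ℝ} (hv : 0 < v) (x : E) : 0 < isoGaussianDensity E v x := by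
  unfold isoGaussianDensity; positivity

lemma continuous_isoGaussianDensity (v : ℝ) : Continuous (isoGaussianDensity E v) := by
  unfold isoGaussianDensity; fun_prop

lemma integral_isoGaussianDensity_mul_cexp {v : ℝ} (hv : 0 < v) (c : ℂ) (w : E) :
    ∫ x, (isoGaussianDensity E v x : ℂ) * Complex.exp (c * inner ℝ w x)
      = Complex.exp (c ^ 2 * v * ‖w‖ ^ 2 / 2) := by
  have hb : 0 < ((1 / (2 * v) : ℝ) : ℂ).re := by
    rw [Complex.ofReal_re]; positivity
  have key := GaussianFourier.integral_cexp_neg_mul_sq_norm_add (V := E) hb c w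
  have h1 : ∀ x : E, (isoGaussianDensity E v x : ℂ) * Complex.exp (c * inner ℝ w x)
      = (((2 * π * v) ^ (-(Module.finrank ℝ E / 2 : ℝ)) : ℝ) : ℂ) *
        Complex.exp (-((1 / (2 * v) : ℝ) : ℂ) * ‖x‖ ^ 2 + c * inner ℝ w x) := by
    intro x
    rw [Complex.exp_add, ← mul_assoc]
    unfold isoGaussianDensity
    push_cast
    rfl
  simp_rw [h1]
  rw [integral_const_mul, key]
  have h2 : (π : ℂ) / ((1 / (2 * v) : ℝ) : ℂ) = ((2 * π * v : ℝ) : ℂ) := by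
    have : (v : ℂ) ≠ 0 := by exact_mod_cast hv.ne'
    push_cast; field_simp
  have h3 : ((Module.finrank ℝ E : ℂ) / 2) = ((Module.finrank ℝ E / 2 : ℝ) : ℂ) := by push_cast; rfl
  rw [h2, h3, ← Complex.ofReal_cpow (by positivity), ← mul_assoc, ← Complex.ofReal_mul,
    ← Real.rpow_add (by positivity)]
  simp only [neg_add_cancel, Real.rpow_zero, Complex.ofReal_one, one_mul]
  congr 1
  have : (v : ℂ) ≠ 0 := by exact_mod_cast hv.ne'
  push_cast; field_simp; ring

lemma integrable_isoGaussianDensity_mul_exp {v : ℝ} (hv : 0 < v) (w : E) :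
    Integrable fun x => isoGaussianDensity E v x * exp (inner ℝ w x) := by
  have h := integral_isoGaussianDensity_mul_cexp hv 1 w
  have hi : Integrable fun x => (isoGaussianDensity E v x : ℂ) * Complex.exp (1 * inner ℝ w x) := by
    by_contra hc
    rw [integral_undef hc] at h
    exact Complex.exp_ne_zero _ h.symm
  convert hi.re using 2 with x
  rw [one_mul, ← Complex.ofReal_exp, ← Complex.ofReal_mul]
  exact (Complex.ofReal_re _).symm

lemma integral_isoGaussianDensity_mul_exp {v : ℝ} (hv : 0 < v) (w : E) :
    ∫ x, isoGaussianDensity E v x * exp (inner ℝ w x) = exp (v * ‖w‖ ^ 2 / 2) := by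
  have h := integral_isoGaussianDensity_mul_cexp hv 1 w
  have : ∀ x : E, (isoGaussianDensity E v x : ℂ) * Complex.exp (1 * inner ℝ w x)
      = ((isoGaussianDensity E v x * exp (inner ℝ w x) : ℝ) : ℂ) := by
    intro x; push_cast; rw [one_mul]
  simp_rw [this] at h
  rw [integral_complex_ofReal] at h
  have h' : Complex.exp (1 ^ 2 * v * ‖w‖ ^ 2 / 2) = ((exp (v * ‖w‖ ^ 2 / 2) : ℝ) : ℂ) := by
    push_cast; congr 1; ring
  rw [h'] at h
  exact_mod_cast h

lemma lintegral_isoGaussian {v : ℝ} {f : E → ℝ≥0∞} (hf : Measurable f) :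
    ∫⁻ x, f x ∂isoGaussian E v = ∫⁻ x, ENNReal.ofReal (isoGaussianDensity E v x) * f x := by
  unfold isoGaussian
  rw [lintegral_withDensity_eq_lintegral_mul _
    ((continuous_isoGaussianDensity v).measurable.ennreal_ofReal) hf]
  rfl

lemma lintegral_exp_inner_isoGaussian {v : ℝ} (hv : 0 < v) (w : E) :
    ∫⁻ x, ENNReal.ofReal (exp (inner ℝ w x)) ∂isoGaussian E v
      = ENNReal.ofReal (exp (v * ‖w‖ ^ 2 / 2)) := by
  rw [lintegral_isoGaussian (by fun_prop), ← integral_isoGaussianDensity_mul_exp hv w,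
    ofReal_integral_eq_lintegral_ofReal (integrable_isoGaussianDensity_mul_exp hv w)
      (ae_of_all _ fun x => by have := isoGaussianDensity_pos hv x; positivity)]
  congr 1 with x
  rw [ENNReal.ofReal_mul (isoGaussianDensity_pos hv x).le]

lemma isProbabilityMeasure_isoGaussian {v : ℝ} (hv : 0 < v) :
    IsProbabilityMeasure (isoGaussian E v) := by
  refine ⟨?_⟩
  have := lintegral_exp_inner_isoGaussian (E := E) hv 0
  simpa using this

lemma charFun_isoGaussian {v : ℝ} (hv : 0 < v) (t : E) :
    charFun (isoGaussian E v) t = Complex.exp (-(v * ‖t‖ ^ 2 / 2)) := by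
  rw [charFun_apply]
  unfold isoGaussian
  rw [integral_withDensity_eq_integral_toReal_smul
    ((continuous_isoGaussianDensity v).measurable.ennreal_ofReal) (by simp)]
  refine Eq.trans ?_ ((integral_isoGaussianDensity_mul_cexp hv Complex.I t).trans ?_)
  · congr 1 with x
    rw [ENNReal.toReal_ofReal (isoGaussianDensity_pos hv x).le, real_inner_comm, Complex.real_smul,
      mul_comm Complex.I]
  · rw [Complex.I_sq]; ring_nf

lemma isoGaussian_conv {u v : ℝ} (hu : 0 < u) (hv : 0 < v) :
    (isoGaussian E u).conv (isoGaussian E v) = isoGaussian E (u + v) := by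
  have := isProbabilityMeasure_isoGaussian (E := E) hu
  have := isProbabilityMeasure_isoGaussian (E := E) hv
  have := isProbabilityMeasure_isoGaussian (E := E) (add_pos hu hv)
  refine Measure.ext_of_charFun ?_
  ext t
  rw [charFun_conv, charFun_isoGaussian hu, charFun_isoGaussian hv,
    charFun_isoGaussian (add_pos hu hv), ← Complex.exp_add]
  congr 1; push_cast; ring

end Gaussian

section Step

variable {E : Type*} [NormedAddCommGroup E] [InnerProductSpace ℝ E] [FiniteDimensional ℝ E]
  [MeasurableSpace E] [BorelSpace E]

lemma ae_pi_norm_le {ν : Measure E} [IsProbabilityMeasure ν] {R : ℝ} (hR : ∀ᵐ z ∂ν, ‖z‖ ≤ R)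
    (k : ℕ) : ∀ᵐ z ∂Measure.pi (fun _ : Fin k => ν), ∀ i, ‖z i‖ ≤ R := by
  rw [ae_all_iff]
  intro i
  exact (measurePreserving_eval (fun _ : Fin k => ν) i).quasiMeasurePreserving.ae hR

lemma integrable_of_continuous_of_norm_le {ν : Measure E} [IsFiniteMeasure ν] {R : ℝ}
    (hR : ∀ᵐ z ∂ν, ‖z‖ ≤ R) {G : Type*} [NormedAddCommGroup G] {f : E → G} (hf : Continuous f) :
    Integrable f ν := by
  obtain ⟨C, hC⟩ := (isCompact_closedBall (0 : E) R).exists_bound_of_continuousOn hf.continuousOn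
  refine Integrable.of_bound hf.aestronglyMeasurable C ?_
  filter_upwards [hR] with z hz
  exact hC z (by simpa using hz)

lemma norm_integral_id_le {ν : Measure E} [IsProbabilityMeasure ν] {R : ℝ}
    (hR : ∀ᵐ z ∂ν, ‖z‖ ≤ R) : ‖∫ z, z ∂ν‖ ≤ R := by
  simpa using norm_integral_le_of_norm_le_const hR

/-- The exponent obtained by integrating out a Gaussian variable from a product of exponentials. -/
def fluctuation {k : ℕ} (a m : E) (z : Fin k → E) : ℝ :=
  inner ℝ a (∑ i, (z i - m)) + ‖∑ i, (z i - m)‖ ^ 2 / 2 - (∑ i, (‖z i‖ ^ 2 - ‖m‖ ^ 2)) / 2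

lemma continuous_fluctuation {k : ℕ} (a m : E) :
    Continuous (fluctuation a m : (Fin k → E) → ℝ) := by
  unfold fluctuation; fun_prop

lemma abs_fluctuation_le {k : ℕ} {a m : E} {R : ℝ} (ha : ‖a‖ ≤ k * R) (hm : ‖m‖ ≤ R)
    {z : Fin k → E} (hz : ∀ i, ‖z i‖ ≤ R) : |fluctuation a m z| ≤ 5 * k ^ 2 * R ^ 2 := by
  have hR : 0 ≤ R := (norm_nonneg _).trans hm
  have hS : ‖∑ i, (z i - m)‖ ≤ k * (2 * R) := by
    refine (norm_sum_le _ _).trans ?_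
    refine (Finset.sum_le_sum (g := fun _ => 2 * R) fun i _ => ?_).trans (by simp)
    exact (norm_sub_le _ _).trans (by linarith [hz i])
  have h1 : |inner ℝ a (∑ i, (z i - m))| ≤ (k * R) * (k * (2 * R)) :=
    (abs_real_inner_le_norm _ _).trans (by gcongr)
  have h2 : ‖∑ i, (z i - m)‖ ^ 2 ≤ (k * (2 * R)) ^ 2 := by gcongr
  have h3 : |∑ i, (‖z i‖ ^ 2 - ‖m‖ ^ 2)| ≤ k * R ^ 2 := by
    refine (Finset.abs_sum_le_sum_abs _ _).trans ?_
    refine (Finset.sum_le_sum (g := fun _ => R ^ 2) fun i _ => ?_).trans (by simp)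
    have h4 : ‖z i‖ ^ 2 ≤ R ^ 2 := by have := hz i; gcongr
    have h5 : ‖m‖ ^ 2 ≤ R ^ 2 := by gcongr
    rw [abs_le]; constructor <;> nlinarith [sq_nonneg ‖z i‖, sq_nonneg ‖m‖]
  have hk : (k : ℝ) * R ^ 2 ≤ k ^ 2 * R ^ 2 := by
    have : (k : ℝ) ≤ k ^ 2 := by exact_mod_cast Nat.le_self_pow two_ne_zero k
    gcongr
  unfold fluctuation
  rw [abs_le] at *
  constructor <;> nlinarith [sq_nonneg ‖∑ i, (z i - m)‖, sq_nonneg ((k : ℝ) * R)]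

lemma integral_fluctuation {ν : Measure E} [IsProbabilityMeasure ν] {R : ℝ}
    (hR : ∀ᵐ z ∂ν, ‖z‖ ≤ R) (k : ℕ) (a : E) :
    ∫ z, fluctuation a (∫ y, y ∂ν) z ∂Measure.pi (fun _ : Fin k => ν) = 0 := by
  set m := ∫ y, y ∂ν with hm
  set μ := Measure.pi (fun _ : Fin k => ν) with hμ
  have hae := ae_pi_norm_le hR k
  have hmR : ‖m‖ ≤ R := norm_integral_id_le hR
  have hint : ∀ (f : (Fin k → E) → ℝ) (C : ℝ), Continuous f →
      (∀ z, (∀ i, ‖z i‖ ≤ R) → ‖f z‖ ≤ C) → Integrable f μ := by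
    intro f C hf hC
    refine Integrable.of_bound hf.aestronglyMeasurable C ?_
    filter_upwards [hae] with z hz using hC z hz
  have hw : ∀ z : E, ‖z‖ ≤ R → ‖z - m‖ ≤ 2 * R := fun z hz =>
    (norm_sub_le _ _).trans (by linarith)
  have hcent : ∫ z, (z - m) ∂ν = 0 := by
    rw [integral_sub (f := fun z : E => z) (integrable_of_continuous_of_norm_le hR continuous_id)
      (integrable_const _)]
    simp [hm]
  have heval : ∀ (i : Fin k) (f : E → ℝ), Continuous f → ∫ z, f (z i) ∂μ = ∫ z, f z ∂ν := by
    intro i f hf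
    rw [← (measurePreserving_eval (fun _ : Fin k => ν) i).map_eq,
      integral_map (measurable_pi_apply i).aemeasurable hf.aestronglyMeasurable]
  have hlin : ∀ b : E, ∫ z, inner ℝ b (z - m) ∂ν = 0 := by
    intro b
    rw [integral_inner (integrable_of_continuous_of_norm_le hR (by fun_prop)), hcent,
      inner_zero_right]
  have hvar : ∫ z, ‖z - m‖ ^ 2 ∂ν = ∫ z, (‖z‖ ^ 2 - ‖m‖ ^ 2) ∂ν := by
    have : ∀ z : E, ‖z - m‖ ^ 2 = (‖z‖ ^ 2 - ‖m‖ ^ 2) - 2 * inner ℝ m (z - m) := by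
      intro z
      rw [norm_sub_sq_real, inner_sub_right, real_inner_self_eq_norm_sq, real_inner_comm]
      ring
    simp_rw [this]
    rw [integral_sub (integrable_of_continuous_of_norm_le hR (by fun_prop))
      (integrable_of_continuous_of_norm_le hR (by fun_prop)), integral_const_mul, hlin]
    simp
  have hcross : ∀ i j : Fin k, i ≠ j → ∫ z, inner ℝ (z i - m) (z j - m) ∂μ = 0 := by
    intro i j hij
    have hind : ProbabilityTheory.IndepFun (fun z : Fin k → E => z i - m) (fun z => z j - m) μ :=
      (ProbabilityTheory.iIndepFun_pi (μ := fun _ : Fin k => ν) (X := fun _ z => z - m)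
        (fun _ => by fun_prop)).indepFun hij
    have hi : ∀ l : Fin k, Integrable (fun z : Fin k → E => z l - m) μ := fun l =>
      (measurePreserving_eval (fun _ : Fin k => ν) l).integrable_comp_of_integrable
        (g := fun z => z - m) (integrable_of_continuous_of_norm_le hR (by fun_prop))
    have h0 : ∫ z : Fin k → E, (z i - m) ∂μ = 0 := by
      have hg : Continuous fun z : E => z - m := by fun_prop
      rw [← hcent, ← (measurePreserving_eval (fun _ : Fin k => ν) i).map_eq,
        integral_map (measurable_pi_apply i).aemeasurable hg.aestronglyMeasurable]
    have := hind.integral_bilin (B := innerSL ℝ) (hi i) (hi j)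
    rw [h0, map_zero] at this
    exact this
  have hpair : ∀ i j : Fin k, ∫ z, inner ℝ (z i - m) (z j - m) ∂μ
      = if i = j then ∫ z, (‖z‖ ^ 2 - ‖m‖ ^ 2) ∂ν else 0 := by
    intro i j
    split_ifs with h
    · subst h
      simp_rw [real_inner_self_eq_norm_sq]
      rw [heval i (fun z => ‖z - m‖ ^ 2) (by fun_prop), hvar]
    · exact hcross i j h
  have hipair : ∀ i j : Fin k, Integrable (fun z => inner ℝ (z i - m) (z j - m)) μ := by
    intro i j
    refine hint _ ((2 * R) * (2 * R)) (by fun_prop) fun z hz => ?_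
    refine (norm_inner_le_norm _ _).trans ?_
    have := hw _ (hz i)
    have := hw _ (hz j)
    gcongr
    linarith [norm_nonneg (z i - m)]
  have hisq : ∀ i : Fin k, Integrable (fun z : Fin k → E => ‖z i‖ ^ 2 - ‖m‖ ^ 2) μ := by
    intro i
    exact (measurePreserving_eval (fun _ : Fin k => ν) i).integrable_comp_of_integrable
      (g := fun z => ‖z‖ ^ 2 - ‖m‖ ^ 2) (integrable_of_continuous_of_norm_le hR (by fun_prop))
  have hilin : ∀ i : Fin k, Integrable (fun z : Fin k → E => inner ℝ a (z i - m)) μ := by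
    intro i
    exact (measurePreserving_eval (fun _ : Fin k => ν) i).integrable_comp_of_integrable
      (g := fun z => inner ℝ a (z - m)) (integrable_of_continuous_of_norm_le hR (by fun_prop))
  have hexp : ∀ z : Fin k → E, fluctuation a m z = ∑ i, inner ℝ a (z i - m)
      + (∑ i, ∑ j, inner ℝ (z i - m) (z j - m)) / 2 - (∑ i, (‖z i‖ ^ 2 - ‖m‖ ^ 2)) / 2 := by
    intro z
    unfold fluctuation
    rw [inner_sum, ← real_inner_self_eq_norm_sq (∑ i, (z i - m)), sum_inner]
    simp_rw [inner_sum]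
  simp_rw [hexp]
  rw [integral_sub, integral_add, integral_div, integral_div, integral_finsetSum, integral_finsetSum,
    integral_finsetSum]
  · have e1 : ∀ i : Fin k, ∫ z, inner ℝ a (z i - m) ∂μ = 0 := fun i => by
      rw [heval i (fun z => inner ℝ a (z - m)) (by fun_prop), hlin]
    have e2 : ∀ i : Fin k, ∫ z, (‖z i‖ ^ 2 - ‖m‖ ^ 2) ∂μ = ∫ z, (‖z‖ ^ 2 - ‖m‖ ^ 2) ∂ν := fun i =>
      heval i (fun z => ‖z‖ ^ 2 - ‖m‖ ^ 2) (by fun_prop)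
    have e3 : ∀ i : Fin k, ∫ z, ∑ j, inner ℝ (z i - m) (z j - m) ∂μ
        = ∫ z, (‖z‖ ^ 2 - ‖m‖ ^ 2) ∂ν := fun i => by
      rw [integral_finsetSum _ fun j _ => hipair i j]
      simp [hpair]
    simp only [e1, e2, e3]
    simp
  · exact fun i _ => hisq i
  · exact fun i _ => integrable_finsetSum _ fun j _ => hipair i j
  · exact fun i _ => hilin i
  · exact integrable_finsetSum _ fun i _ => hilin i
  · exact (integrable_finsetSum _ fun i _ => integrable_finsetSum _ fun j _ => hipair i j).div_const _
  · exact (integrable_finsetSum _ fun i _ => hilin i).add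
      ((integrable_finsetSum _ fun i _ =>
        integrable_finsetSum _ fun j _ => hipair i j).div_const _)
  · exact (integrable_finsetSum _ fun i _ => hisq i).div_const _

lemma integral_exp_fluctuation_le {ν : Measure E} [IsProbabilityMeasure ν] {R : ℝ}
    (hR : ∀ᵐ z ∂ν, ‖z‖ ≤ R) {k : ℕ} {a : E} (ha : ‖a‖ ≤ k * R) {h : ℝ} (hh : 0 ≤ h)
    (hsmall : h * (5 * k ^ 2 * R ^ 2) ≤ 1) :
    ∫ z, exp (h * fluctuation a (∫ y, y ∂ν) z) ∂Measure.pi (fun _ : Fin k => ν)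
      ≤ 1 + (h * (5 * k ^ 2 * R ^ 2)) ^ 2 := by
  set m := ∫ y, y ∂ν with hm
  set D := 5 * (k : ℝ) ^ 2 * R ^ 2
  have hb : ∀ᵐ z ∂Measure.pi (fun _ : Fin k => ν), |fluctuation a m z| ≤ D := by
    filter_upwards [ae_pi_norm_le hR k] with z hz
    exact abs_fluctuation_le ha (norm_integral_id_le hR) hz
  have hD : 0 ≤ D := by positivity
  have hcont := continuous_fluctuation (k := k) a m
  have hi : Integrable (fluctuation a m) (Measure.pi (fun _ : Fin k => ν)) :=
    Integrable.of_bound hcont.aestronglyMeasurable D hb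
  calc _ ≤ ∫ z, (1 + h * fluctuation a m z + (h * D) ^ 2) ∂Measure.pi (fun _ : Fin k => ν) := by
        refine integral_mono_of_nonneg (ae_of_all _ fun z => (exp_pos _).le)
          (((integrable_const _).add (hi.const_mul h)).add (integrable_const _)) ?_
        filter_upwards [hb] with z hz
        have h1 : |h * fluctuation a m z| ≤ h * D := by
          rw [abs_mul, abs_of_nonneg hh]; gcongr
        have h2 := Real.abs_exp_sub_one_sub_id_le (h1.trans hsmall)
        have h3 : (h * fluctuation a m z) ^ 2 ≤ (h * D) ^ 2 := by
          rw [← sq_abs]; gcongr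
        have h4 := (abs_le.1 h2).2
        linarith
    _ = _ := by
        rw [integral_add (f := fun z => 1 + h * fluctuation a m z)
            ((integrable_const _).add (hi.const_mul h)) (integrable_const _),
          integral_add (integrable_const _) (hi.const_mul h), integral_const_mul,
          integral_fluctuation hR]
        simp

end Step

section BrascampLieb

variable {E : Type*} [NormedAddCommGroup E] [InnerProductSpace ℝ E] [FiniteDimensional ℝ E]
  [MeasurableSpace E] [BorelSpace E]

/-- The Laplace transform at `x` of `ρ` damped by the Gaussian weight `exp (-s ‖z‖² / 2)`. -/
def gaussLaplace (ρ : Measure E) (s : ℝ) (x : E) : ℝ≥0∞ :=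
  ∫⁻ z, ENNReal.ofReal (exp (inner ℝ x z - s * ‖z‖ ^ 2 / 2)) ∂ρ

lemma measurable_gaussLaplace (ρ : Measure E) [SFinite ρ] (s : ℝ) :
    Measurable (gaussLaplace ρ s) := by
  unfold gaussLaplace
  refine Measurable.lintegral_prod_right' (f := fun p : E × E =>
    ENNReal.ofReal (exp (inner ℝ p.1 p.2 - s * ‖p.2‖ ^ 2 / 2))) ?_
  have : Continuous fun p : E × E => exp (inner ℝ p.1 p.2 - s * ‖p.2‖ ^ 2 / 2) := by fun_prop
  exact this.measurable.ennreal_ofReal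

/-- The Laplace transform of the measure recentered at its mean. -/
def centeredLaplace (ν : Measure E) (m : E) (h : ℝ) (x : E) : ℝ :=
  ∫ z, exp (inner ℝ x (z - m) - h / 2 * (‖z‖ ^ 2 - ‖m‖ ^ 2)) ∂ν

lemma measurable_centeredLaplace (ν : Measure E) [SFinite ν] (m : E) (h : ℝ) :
    Measurable (centeredLaplace ν m h) := by
  unfold centeredLaplace
  have : Continuous fun p : E × E =>
    exp (inner ℝ p.1 (p.2 - m) - h / 2 * (‖p.2‖ ^ 2 - ‖m‖ ^ 2)) := by fun_prop
  exact (this.stronglyMeasurable.integral_prod_right').measurable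

lemma centeredLaplace_nonneg (ν : Measure E) (m : E) (h : ℝ) (x : E) :
    0 ≤ centeredLaplace ν m h x :=
  integral_nonneg fun _ => (exp_pos _).le

lemma gaussLaplace_eq_centeredLaplace {ν : Measure E} [IsFiniteMeasure ν] {R : ℝ}
    (hR : ∀ᵐ z ∂ν, ‖z‖ ≤ R) (m : E) (h : ℝ) (x : E) :
    gaussLaplace ν h x = ENNReal.ofReal
      (exp (inner ℝ x m - h * ‖m‖ ^ 2 / 2) * centeredLaplace ν m h x) := by
  unfold gaussLaplace centeredLaplace
  rw [← integral_const_mul, ← ofReal_integral_eq_lintegral_ofReal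
    (integrable_of_continuous_of_norm_le hR (by fun_prop)) (ae_of_all _ fun z => (exp_pos _).le)]
  congr 2 with z
  rw [← exp_add, inner_sub_right]
  congr 1; ring

lemma lintegral_exp_mul_centeredLaplace_pow_le {ν : Measure E} [IsProbabilityMeasure ν] {R : ℝ}
    (hR : ∀ᵐ z ∂ν, ‖z‖ ≤ R) {k : ℕ} {a : E} (ha : ‖a‖ ≤ k * R) {h : ℝ} (hh : 0 < h)
    (hsmall : h * (5 * k ^ 2 * R ^ 2) ≤ 1) :
    ∫⁻ x, ENNReal.ofReal (exp (inner ℝ a x - h * ‖a‖ ^ 2 / 2)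
        * centeredLaplace ν (∫ y, y ∂ν) h x ^ k) ∂isoGaussian E h
      ≤ ENNReal.ofReal (1 + (h * (5 * k ^ 2 * R ^ 2)) ^ 2) := by
  have := isProbabilityMeasure_isoGaussian (E := E) hh
  set m := ∫ y, y ∂ν with hm
  set μ := Measure.pi (fun _ : Fin k => ν) with hμ
  have h1 : ∀ x : E, ENNReal.ofReal (exp (inner ℝ a x - h * ‖a‖ ^ 2 / 2)
        * centeredLaplace ν m h x ^ k)
      = ∫⁻ z, ENNReal.ofReal (exp (inner ℝ a x - h * ‖a‖ ^ 2 / 2)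
        * ∏ i, exp (inner ℝ x (z i - m) - h / 2 * (‖z i‖ ^ 2 - ‖m‖ ^ 2))) ∂μ := by
    intro x
    have hi : Integrable (fun z : Fin k → E =>
        ∏ i, exp (inner ℝ x (z i - m) - h / 2 * (‖z i‖ ^ 2 - ‖m‖ ^ 2))) μ :=
      Integrable.fintype_prod (f := fun (_ : Fin k) (z : E) =>
        exp (inner ℝ x (z - m) - h / 2 * (‖z‖ ^ 2 - ‖m‖ ^ 2)))
        fun _ => integrable_of_continuous_of_norm_le hR (by fun_prop)
    rw [← ofReal_integral_eq_lintegral_ofReal (hi.const_mul _)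
      (ae_of_all _ fun z => by positivity), integral_const_mul]
    congr 2
    rw [integral_fintype_prod_eq_prod (fun (_ : Fin k) (z : E) =>
        exp (inner ℝ x (z - m) - h / 2 * (‖z‖ ^ 2 - ‖m‖ ^ 2)))]
    simp [centeredLaplace]
  simp_rw [h1]
  have hcont : Continuous fun p : E × (Fin k → E) =>
      exp (inner ℝ a p.1 - h * ‖a‖ ^ 2 / 2)
        * ∏ i, exp (inner ℝ p.1 (p.2 i - m) - h / 2 * (‖p.2 i‖ ^ 2 - ‖m‖ ^ 2)) := by fun_prop
  rw [lintegral_lintegral_swap hcont.measurable.ennreal_ofReal.aemeasurable]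
  have h2 : ∀ z : Fin k → E, ∫⁻ x, ENNReal.ofReal (exp (inner ℝ a x - h * ‖a‖ ^ 2 / 2)
        * ∏ i, exp (inner ℝ x (z i - m) - h / 2 * (‖z i‖ ^ 2 - ‖m‖ ^ 2))) ∂isoGaussian E h
      = ENNReal.ofReal (exp (h * fluctuation a m z)) := by
    intro z
    have h3 : ∀ x : E, exp (inner ℝ a x - h * ‖a‖ ^ 2 / 2)
        * ∏ i, exp (inner ℝ x (z i - m) - h / 2 * (‖z i‖ ^ 2 - ‖m‖ ^ 2))
        = exp (- (h * ‖a‖ ^ 2 / 2) - h / 2 * ∑ i, (‖z i‖ ^ 2 - ‖m‖ ^ 2))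
          * exp (inner ℝ (a + ∑ i, (z i - m)) x) := by
      intro x
      rw [← exp_sum, ← exp_add, ← exp_add, Finset.sum_sub_distrib, ← inner_sum, ← Finset.mul_sum,
        inner_add_left, real_inner_comm x (∑ i, (z i - m))]
      congr 1; ring
    simp_rw [h3, ENNReal.ofReal_mul (exp_pos _).le]
    rw [lintegral_const_mul _ (by fun_prop), lintegral_exp_inner_isoGaussian hh,
      ← ENNReal.ofReal_mul (exp_pos _).le, ← exp_add, norm_add_sq_real]
    unfold fluctuation
    congr 2; ring
  simp_rw [h2]
  have hb : ∀ᵐ z ∂μ, ‖exp (h * fluctuation a m z)‖ ≤ exp 1 := by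
    filter_upwards [ae_pi_norm_le hR k] with z hz
    rw [Real.norm_eq_abs, abs_of_pos (exp_pos _), exp_le_exp]
    refine le_trans ?_ hsmall
    gcongr
    exact (le_abs_self _).trans (abs_fluctuation_le ha (norm_integral_id_le hR) hz)
  have hc : Continuous fun z : Fin k → E => exp (h * fluctuation a m z) := by
    have := continuous_fluctuation (k := k) a m
    fun_prop
  rw [← ofReal_integral_eq_lintegral_ofReal
    (Integrable.of_bound hc.aestronglyMeasurable _ hb) (ae_of_all _ fun z => (exp_pos _).le)]
  exact ENNReal.ofReal_le_ofReal (integral_exp_fluctuation_le hR ha hh.le hsmall)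

variable {J : Type*} [Fintype J]

lemma prod_rpow_le_weighted_sum_pow {c : ℝ} (hc : 0 < c) {k : ℕ} (hk0 : 0 < k)
    (hk : c * Fintype.card J ≤ k) {y : J → ℝ} (hy : ∀ j, 0 ≤ y j) :
    ∏ j, y j ^ c ≤ (1 - c * Fintype.card J / k) + ∑ j, c / k * y j ^ k := by
  have hk' : (0 : ℝ) < k := by exact_mod_cast hk0
  have := Real.geom_mean_le_arith_mean_weighted (Finset.univ : Finset (Option J))
    (fun o => o.elim (1 - c * Fintype.card J / k) fun _ => c / k)
    (fun o => o.elim 1 fun j => y j ^ k) ?_ ?_ ?_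
  · simp only [Fintype.prod_option, Fintype.sum_option, Option.elim, Real.one_rpow, one_mul,
      mul_one] at this
    refine le_trans (le_of_eq ?_) this
    refine Finset.prod_congr rfl fun j _ => ?_
    rw [← Real.rpow_natCast, ← Real.rpow_mul (hy j)]
    congr 1; field_simp
  · rintro (_ | j) -
    · simp only [Option.elim]
      rw [sub_nonneg, div_le_one hk']; exact hk
    · simp only [Option.elim]; positivity
  · simp only [Fintype.sum_option, Option.elim, Finset.sum_const, Finset.card_univ, nsmul_eq_mul]
    ring
  · rintro (_ | j) -
    · simp
    · exact pow_nonneg (hy j) _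

lemma lintegral_prod_gaussLaplace_le_of_isProbabilityMeasure (ν : J → Measure E)
    [∀ j, IsProbabilityMeasure (ν j)] {R : ℝ} (hR0 : 0 ≤ R) (hR : ∀ j, ∀ᵐ z ∂ν j, ‖z‖ ≤ R)
    {c : ℝ} (hc : 0 < c) {k : ℕ} (hk0 : 0 < k) (hk : c * Fintype.card J ≤ k)
    (hframe : ‖∑ j, c • ∫ z, z ∂ν j‖ ^ 2 ≤ c * ∑ j, ‖∫ z, z ∂ν j‖ ^ 2)
    {h : ℝ} (hh : 0 < h) (hsmall : h * (5 * k ^ 2 * R ^ 2) ≤ 1) :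
    ∫⁻ x, ∏ j, gaussLaplace (ν j) h x ^ c ∂isoGaussian E h
      ≤ ENNReal.ofReal (1 + (h * (5 * k ^ 2 * R ^ 2)) ^ 2) := by
  have hk' : (0 : ℝ) < k := by exact_mod_cast hk0
  have := isProbabilityMeasure_isoGaussian (E := E) hh
  set m : J → E := fun j => ∫ z, z ∂ν j with hm
  set a : E := ∑ j, c • m j with ha
  set B := 1 + (h * (5 * (k : ℝ) ^ 2 * R ^ 2)) ^ 2 with hB
  have haR : ‖a‖ ≤ k * R := by
    refine le_of_sq_le_sq ?_ (by positivity)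
    have h1 : ∑ j, ‖m j‖ ^ 2 ≤ Fintype.card J * R ^ 2 := by
      refine (Finset.sum_le_sum (g := fun _ => R ^ 2) fun j _ => ?_).trans (by simp)
      have := norm_integral_id_le (hR j)
      gcongr
    have h2 : (k : ℝ) * R ^ 2 ≤ k ^ 2 * R ^ 2 := by
      have : (k : ℝ) ≤ k ^ 2 := by exact_mod_cast Nat.le_self_pow two_ne_zero k
      gcongr
    calc ‖a‖ ^ 2 ≤ c * ∑ j, ‖m j‖ ^ 2 := hframe
      _ ≤ c * (Fintype.card J * R ^ 2) := by gcongr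
      _ = (c * Fintype.card J) * R ^ 2 := by ring
      _ ≤ k * R ^ 2 := by gcongr
      _ ≤ _ := by rw [mul_pow]; exact h2
  set g : E → ℝ := fun x => exp (inner ℝ a x - h * ‖a‖ ^ 2 / 2) with hg
  have hgm : Measurable g := by fun_prop
  set w := 1 - c * Fintype.card J / k with hw
  have hw0 : 0 ≤ w := by rw [hw, sub_nonneg, div_le_one hk']; exact hk
  have hpt : ∀ x, ∏ j, gaussLaplace (ν j) h x ^ c ≤ ENNReal.ofReal w * ENNReal.ofReal (g x)
      + ∑ j, ENNReal.ofReal (c / k) *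
        ENNReal.ofReal (g x * centeredLaplace (ν j) (m j) h x ^ k) := by
    intro x
    have hZ : ∀ j, 0 ≤ centeredLaplace (ν j) (m j) h x := fun j => centeredLaplace_nonneg _ _ _ _
    have e1 : ∀ j, gaussLaplace (ν j) h x ^ c = ENNReal.ofReal
        (exp (c * (inner ℝ x (m j) - h * ‖m j‖ ^ 2 / 2)) *
          centeredLaplace (ν j) (m j) h x ^ c) := by
      intro j
      rw [gaussLaplace_eq_centeredLaplace (hR j) (m j),
        ENNReal.ofReal_rpow_of_nonneg (mul_nonneg (exp_pos _).le (hZ j)) hc.le,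
        Real.mul_rpow (exp_pos _).le (hZ j), ← Real.exp_mul, mul_comm c]
    simp_rw [e1]
    rw [← ENNReal.ofReal_prod_of_nonneg fun j _ =>
      mul_nonneg (exp_pos _).le (Real.rpow_nonneg (hZ j) _), Finset.prod_mul_distrib, ← exp_sum]
    have e2 : ∑ j, c * (inner ℝ x (m j) - h * ‖m j‖ ^ 2 / 2) ≤ inner ℝ a x - h * ‖a‖ ^ 2 / 2 := by
      have : ∑ j, c * (inner ℝ x (m j) - h * ‖m j‖ ^ 2 / 2)
          = inner ℝ a x - h / 2 * (c * ∑ j, ‖m j‖ ^ 2) := by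
        rw [real_inner_comm, ha, inner_sum, Finset.mul_sum, Finset.mul_sum,
          ← Finset.sum_sub_distrib]
        refine Finset.sum_congr rfl fun j _ => ?_
        rw [inner_smul_right]; ring
      rw [this]
      have : h / 2 * ‖a‖ ^ 2 ≤ h / 2 * (c * ∑ j, ‖m j‖ ^ 2) := by gcongr
      linarith
    have e3 := prod_rpow_le_weighted_sum_pow hc hk0 hk hZ
    calc _ ≤ ENNReal.ofReal (g x * (w + ∑ j, c / k * centeredLaplace (ν j) (m j) h x ^ k)) := by
          refine ENNReal.ofReal_le_ofReal (mul_le_mul (exp_le_exp.2 e2) e3 ?_ (exp_pos _).le)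
          exact Finset.prod_nonneg fun j _ => Real.rpow_nonneg (hZ j) _
      _ = _ := by
          rw [mul_add, Finset.mul_sum, ENNReal.ofReal_add, ENNReal.ofReal_sum_of_nonneg,
            mul_comm (g x) w, ENNReal.ofReal_mul hw0]
          · congr 1
            refine Finset.sum_congr rfl fun j _ => ?_
            rw [← ENNReal.ofReal_mul (by positivity)]
            congr 1; ring
          · exact fun j _ => mul_nonneg (exp_pos _).le
              (mul_nonneg (by positivity) (pow_nonneg (hZ j) _))
          · exact mul_nonneg (exp_pos _).le hw0
          · exact Finset.sum_nonneg fun j _ => mul_nonneg (exp_pos _).le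
              (mul_nonneg (by positivity) (pow_nonneg (hZ j) _))
  have hg1 : ∫⁻ x, ENNReal.ofReal (g x) ∂isoGaussian E h = 1 := by
    have : ∀ x, ENNReal.ofReal (g x) = ENNReal.ofReal (exp (-(h * ‖a‖ ^ 2 / 2)))
        * ENNReal.ofReal (exp (inner ℝ a x)) := by
      intro x
      rw [← ENNReal.ofReal_mul (exp_pos _).le, ← exp_add, hg]
      congr 2; ring_nf
    simp_rw [this]
    rw [lintegral_const_mul _ (by fun_prop), lintegral_exp_inner_isoGaussian hh,
      ← ENNReal.ofReal_mul (exp_pos _).le, ← exp_add]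
    simp
  calc _ ≤ ∫⁻ x, (ENNReal.ofReal w * ENNReal.ofReal (g x)
      + ∑ j, ENNReal.ofReal (c / k) *
        ENNReal.ofReal (g x * centeredLaplace (ν j) (m j) h x ^ k)) ∂isoGaussian E h :=
        lintegral_mono hpt
    _ = ENNReal.ofReal w + ∑ j, ENNReal.ofReal (c / k) *
        ∫⁻ x, ENNReal.ofReal (g x * centeredLaplace (ν j) (m j) h x ^ k) ∂isoGaussian E h := by
        have hZm : ∀ j, Measurable fun x =>
            ENNReal.ofReal (g x * centeredLaplace (ν j) (m j) h x ^ k) := fun j =>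
          (hgm.mul ((measurable_centeredLaplace (ν j) (m j) h).pow_const k)).ennreal_ofReal
        rw [lintegral_add_left (hgm.ennreal_ofReal.const_mul _),
          lintegral_const_mul _ hgm.ennreal_ofReal, hg1, mul_one,
          lintegral_finsetSum _ fun j _ => (hZm j).const_mul _]
        simp_rw [lintegral_const_mul _ (hZm _)]
    _ ≤ ENNReal.ofReal w + ∑ _j : J, ENNReal.ofReal (c / k) * ENNReal.ofReal B := by
        gcongr with j
        exact lintegral_exp_mul_centeredLaplace_pow_le (hR j) haR hh hsmall
    _ = ENNReal.ofReal (w + Fintype.card J * (c / k * B)) := by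
        rw [Finset.sum_const, Finset.card_univ, nsmul_eq_mul, ENNReal.ofReal_add hw0 (by positivity),
          ENNReal.ofReal_mul (by positivity), ENNReal.ofReal_mul (by positivity),
          ENNReal.ofReal_natCast]
    _ ≤ ENNReal.ofReal B := by
        refine ENNReal.ofReal_le_ofReal ?_
        have hB1 : 1 ≤ B := by rw [hB]; nlinarith [sq_nonneg (h * (5 * (k : ℝ) ^ 2 * R ^ 2))]
        have : w + Fintype.card J * (c / k * B) = B - w * (B - 1) := by rw [hw]; ring
        rw [this]
        nlinarith

lemma lintegral_prod_gaussLaplace_le_of_isFiniteMeasure (ρ : J → Measure E)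
    [∀ j, IsFiniteMeasure (ρ j)] {R : ℝ} (hR0 : 0 ≤ R) (hR : ∀ j, ∀ᵐ z ∂ρ j, ‖z‖ ≤ R)
    {F : J → Submodule ℝ E} (hF : ∀ j, ∀ᵐ z ∂ρ j, z ∈ F j)
    {c : ℝ} (hc : 0 < c) {k : ℕ} (hk0 : 0 < k) (hk : c * Fintype.card J ≤ k)
    (hframe : ∀ m : J → E, (∀ j, m j ∈ F j) → ‖∑ j, c • m j‖ ^ 2 ≤ c * ∑ j, ‖m j‖ ^ 2)
    {h : ℝ} (hh : 0 < h) (hsmall : h * (5 * k ^ 2 * R ^ 2) ≤ 1) :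
    ∫⁻ x, ∏ j, gaussLaplace (ρ j) h x ^ c ∂isoGaussian E h
      ≤ ENNReal.ofReal (1 + (h * (5 * k ^ 2 * R ^ 2)) ^ 2) * ∏ j, ρ j univ ^ c := by
  by_cases hz : ∃ j, ρ j = 0
  · obtain ⟨j, hj⟩ := hz
    have : ∀ x, ∏ j, gaussLaplace (ρ j) h x ^ c = 0 := fun x =>
      Finset.prod_eq_zero (Finset.mem_univ j) (by simp [gaussLaplace, hj, hc])
    simp [this]
  push Not at hz
  have hne : ∀ j, ρ j univ ≠ 0 := fun j => by simpa using hz j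
  have hfin : ∀ j, ρ j univ ≠ ∞ := fun j => measure_ne_top _ _
  set ν : J → Measure E := fun j => (ρ j univ)⁻¹ • ρ j with hν
  have hνp : ∀ j, IsProbabilityMeasure (ν j) := fun j =>
    ⟨by simp [hν, ENNReal.inv_mul_cancel (hne j) (hfin j)]⟩
  have hνR : ∀ j, ∀ᵐ z ∂ν j, ‖z‖ ≤ R := fun j => Measure.ae_smul_measure (hR j) _
  have hνF : ∀ j, ∀ᵐ z ∂ν j, z ∈ F j := fun j => Measure.ae_smul_measure (hF j) _
  have hmean : ∀ j, ∫ z, z ∂ν j ∈ F j := fun j =>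
    (F j).convex.integral_mem (F j).closed_of_finiteDimensional (hνF j)
      (integrable_of_continuous_of_norm_le (hνR j) continuous_id)
  have key := lintegral_prod_gaussLaplace_le_of_isProbabilityMeasure ν hR0 hνR hc hk0 hk
    (hframe _ hmean) hh hsmall
  have hlap : ∀ x, ∏ j, gaussLaplace (ρ j) h x ^ c
      = (∏ j, ρ j univ ^ c) * ∏ j, gaussLaplace (ν j) h x ^ c := by
    intro x
    rw [← Finset.prod_mul_distrib]
    refine Finset.prod_congr rfl fun j _ => ?_
    rw [← ENNReal.mul_rpow_of_nonneg _ _ hc.le]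
    congr 1
    simp only [gaussLaplace, hν, lintegral_smul_measure, smul_eq_mul]
    rw [← mul_assoc, ENNReal.mul_inv_cancel (hne j) (hfin j), one_mul]
  simp_rw [hlap]
  rw [lintegral_const_mul _ (Finset.measurable_prod _ fun j _ =>
    (measurable_gaussLaplace (ν j) h).pow_const c), mul_comm]
  gcongr

/-- The measure `ρ` with density `z ↦ exp (⟪x, z⟫ - h ‖z‖² / 2)`. -/
def gaussTilt (ρ : Measure E) (h : ℝ) (x : E) : Measure E :=
  ρ.withDensity fun z => ENNReal.ofReal (exp (inner ℝ x z - h * ‖z‖ ^ 2 / 2))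

lemma gaussTilt_univ (ρ : Measure E) (h : ℝ) (x : E) :
    gaussTilt ρ h x univ = gaussLaplace ρ h x := by
  simp [gaussTilt, gaussLaplace]

lemma gaussLaplace_gaussTilt (ρ : Measure E) (h s : ℝ) (x y : E) :
    gaussLaplace (gaussTilt ρ h x) s y = gaussLaplace ρ (h + s) (x + y) := by
  unfold gaussLaplace gaussTilt
  rw [lintegral_withDensity_eq_lintegral_mul _ (by fun_prop) (by fun_prop)]
  congr 1 with z
  rw [Pi.mul_apply, ← ENNReal.ofReal_mul (exp_pos _).le, ← exp_add, inner_add_left]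
  congr 2; ring

lemma ae_gaussTilt {ρ : Measure E} {p : E → Prop} (hp : ∀ᵐ z ∂ρ, p z) (h : ℝ) (x : E) :
    ∀ᵐ z ∂gaussTilt ρ h x, p z :=
  (withDensity_absolutelyContinuous _ _).ae_le hp

lemma isFiniteMeasure_gaussTilt {ρ : Measure E} [IsFiniteMeasure ρ] {R : ℝ}
    (hR : ∀ᵐ z ∂ρ, ‖z‖ ≤ R) (h : ℝ) (x : E) : IsFiniteMeasure (gaussTilt ρ h x) :=
  isFiniteMeasure_withDensity_ofReal
    (integrable_of_continuous_of_norm_le hR (by fun_prop)).2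

lemma lintegral_prod_gaussLaplace_iterate_le
    {R : ℝ} (hR0 : 0 ≤ R) {F : J → Submodule ℝ E}
    {c : ℝ} (hc : 0 < c) {k : ℕ} (hk0 : 0 < k) (hk : c * Fintype.card J ≤ k)
    (hframe : ∀ m : J → E, (∀ j, m j ∈ F j) → ‖∑ j, c • m j‖ ^ 2 ≤ c * ∑ j, ‖m j‖ ^ 2)
    {h : ℝ} (hh : 0 < h) (hsmall : h * (5 * k ^ 2 * R ^ 2) ≤ 1) (N : ℕ) :
    ∀ (ρ : J → Measure E) [∀ j, IsFiniteMeasure (ρ j)], (∀ j, ∀ᵐ z ∂ρ j, ‖z‖ ≤ R) →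
      (∀ j, ∀ᵐ z ∂ρ j, z ∈ F j) →
    ∫⁻ x, ∏ j, gaussLaplace (ρ j) ((N + 1) * h) x ^ c ∂isoGaussian E ((N + 1) * h)
      ≤ ENNReal.ofReal (1 + (h * (5 * k ^ 2 * R ^ 2)) ^ 2) ^ (N + 1) * ∏ j, ρ j univ ^ c := by
  induction N with
  | zero =>
    intro ρ _ hR hF
    simpa using
      lintegral_prod_gaussLaplace_le_of_isFiniteMeasure ρ hR0 hR hF hc hk0 hk hframe hh hsmall
  | succ N ih =>
    intro ρ _ hR hF
    set B := ENNReal.ofReal (1 + (h * (5 * k ^ 2 * R ^ 2)) ^ 2)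
    have hN : (0 : ℝ) < (N + 1) * h := by positivity
    have := isProbabilityMeasure_isoGaussian (E := E) hN
    have e : ((N + 1 : ℕ) + 1 : ℝ) * h = h + (N + 1) * h := by push_cast; ring
    rw [e, ← isoGaussian_conv hh hN, Measure.lintegral_conv (Finset.measurable_prod _ fun j _ =>
      (measurable_gaussLaplace (ρ j) _).pow_const c)]
    calc _ ≤ ∫⁻ x, B ^ (N + 1) * ∏ j, gaussLaplace (ρ j) h x ^ c ∂isoGaussian E h := by
          refine lintegral_mono fun x => ?_
          have := fun j => isFiniteMeasure_gaussTilt (hR j) h x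
          have := ih (fun j => gaussTilt (ρ j) h x) (fun j => ae_gaussTilt (hR j) h x)
            (fun j => ae_gaussTilt (hF j) h x)
          simpa only [gaussLaplace_gaussTilt, gaussTilt_univ] using this
      _ = B ^ (N + 1) * ∫⁻ x, ∏ j, gaussLaplace (ρ j) h x ^ c ∂isoGaussian E h :=
          lintegral_const_mul _ (Finset.measurable_prod _ fun j _ =>
            (measurable_gaussLaplace (ρ j) h).pow_const c)
      _ ≤ B ^ (N + 1) * (B * ∏ j, ρ j univ ^ c) := by
          gcongr
          exact lintegral_prod_gaussLaplace_le_of_isFiniteMeasure ρ hR0 hR hF hc hk0 hk hframe hh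
            hsmall
      _ = B ^ (N + 1 + 1) * ∏ j, ρ j univ ^ c := by ring

/-- The geometric Brascamp–Lieb inequality for Gaussian mixtures. -/
theorem lintegral_prod_gaussLaplace_le (ρ : J → Measure E)
    [∀ j, IsFiniteMeasure (ρ j)] {R : ℝ} (hR0 : 0 ≤ R) (hR : ∀ j, ∀ᵐ z ∂ρ j, ‖z‖ ≤ R)
    {F : J → Submodule ℝ E} (hF : ∀ j, ∀ᵐ z ∂ρ j, z ∈ F j) {c : ℝ} (hc : 0 < c)
    (hframe : ∀ m : J → E, (∀ j, m j ∈ F j) → ‖∑ j, c • m j‖ ^ 2 ≤ c * ∑ j, ‖m j‖ ^ 2)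
    {T : ℝ} (hT : 0 < T) :
    ∫⁻ x, ∏ j, gaussLaplace (ρ j) T x ^ c ∂isoGaussian E T ≤ ∏ j, ρ j univ ^ c := by
  obtain ⟨k, hk⟩ := exists_nat_ge (c * Fintype.card J + 1)
  have hk0 : 0 < k := by
    have : (0 : ℝ) < k := lt_of_lt_of_le (by positivity) hk
    exact_mod_cast this
  set D := 5 * (k : ℝ) ^ 2 * R ^ 2 with hD
  have hD0 : 0 ≤ D := by positivity
  have hbound : ∀ᶠ N : ℕ in atTop, ∫⁻ x, ∏ j, gaussLaplace (ρ j) T x ^ c ∂isoGaussian E T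
      ≤ ENNReal.ofReal (exp ((T * D) ^ 2 / ((N : ℝ) + 1))) * ∏ j, ρ j univ ^ c := by
    obtain ⟨N₀, hN₀⟩ := exists_nat_ge (T * D)
    filter_upwards [eventually_ge_atTop N₀] with N hN
    have hN1 : (0 : ℝ) < N + 1 := by positivity
    have hNN : (N₀ : ℝ) ≤ N := by exact_mod_cast hN
    have hs : T / (N + 1) * D ≤ 1 := by
      rw [div_mul_eq_mul_div, div_le_one hN1]; linarith
    have := lintegral_prod_gaussLaplace_iterate_le hR0 hc hk0 (by linarith) hframe
      (div_pos hT hN1) hs N ρ hR hF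
    rw [mul_div_cancel₀ T hN1.ne'] at this
    refine this.trans ?_
    gcongr
    rw [← ENNReal.ofReal_pow (by positivity)]
    refine ENNReal.ofReal_le_ofReal ?_
    calc (1 + (T / (N + 1) * D) ^ 2) ^ (N + 1) ≤ (exp ((T / (N + 1) * D) ^ 2)) ^ (N + 1) := by
          gcongr
          rw [add_comm]; exact add_one_le_exp _
      _ = _ := by
          rw [← exp_nat_mul]
          congr 1
          push_cast; field_simp
  have hlim : Tendsto (fun N : ℕ => ENNReal.ofReal (exp ((T * D) ^ 2 / ((N : ℝ) + 1)))
      * ∏ j, ρ j univ ^ c) atTop (𝓝 (1 * ∏ j, ρ j univ ^ c)) := by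
    refine ENNReal.Tendsto.mul_const ?_ (Or.inl one_ne_zero)
    have h0 : Tendsto (fun N : ℕ => (T * D) ^ 2 / ((N : ℝ) + 1)) atTop (𝓝 0) :=
      tendsto_const_nhds.div_atTop (tendsto_natCast_atTop_atTop.atTop_add tendsto_const_nhds)
    have h1 := ENNReal.tendsto_ofReal ((continuous_exp.tendsto 0).comp h0)
    simpa using h1
  rw [one_mul] at hlim
  exact ge_of_tendsto hlim hbound

end BrascampLieb

section Volume

open scoped Pointwise

variable {E H : Type*} [NormedAddCommGroup E] [InnerProductSpace ℝ E] [FiniteDimensional ℝ E]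
  [MeasurableSpace E] [BorelSpace E] [NormedAddCommGroup H] [InnerProductSpace ℝ H]
  [FiniteDimensional ℝ H] [MeasurableSpace H] [BorelSpace H]

lemma isoGaussian_compl_closedBall_le {v : ℝ} (hv : 0 < v) {ε : ℝ} (hε : 0 ≤ ε) :
    isoGaussian H v (Metric.closedBall 0 ε)ᶜ
      ≤ ENNReal.ofReal (2 ^ (Module.finrank ℝ H / 2 : ℝ) * exp (-(ε ^ 2 / (4 * v)))) := by
  have h2v : 0 < 2 * v := by positivity
  have := isProbabilityMeasure_isoGaussian (E := H) h2v
  set κ := 2 ^ (Module.finrank ℝ H / 2 : ℝ) * exp (-(ε ^ 2 / (4 * v))) with hκ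
  have hκ0 : 0 ≤ κ := by positivity
  have hpt : ∀ x ∈ (Metric.closedBall (0 : H) ε)ᶜ,
      isoGaussianDensity H v x ≤ κ * isoGaussianDensity H (2 * v) x := by
    intro x hx
    have hx' : ε ^ 2 ≤ ‖x‖ ^ 2 := by
      have : ε < ‖x‖ := by simpa using hx
      gcongr
    have e : (2 * π * (2 * v)) ^ (-(Module.finrank ℝ H / 2 : ℝ))
        = (2 : ℝ) ^ (-(Module.finrank ℝ H / 2 : ℝ))
          * (2 * π * v) ^ (-(Module.finrank ℝ H / 2 : ℝ)) := by
      rw [← Real.mul_rpow (by positivity) (by positivity)]; ring_nf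
    have e2 : (2 : ℝ) ^ (Module.finrank ℝ H / 2 : ℝ) * 2 ^ (-(Module.finrank ℝ H / 2 : ℝ)) = 1 := by
      rw [← Real.rpow_add (by positivity)]; simp
    have e3 : κ * isoGaussianDensity H (2 * v) x
        = (2 * π * v) ^ (-(Module.finrank ℝ H / 2 : ℝ)) *
          exp (-(ε ^ 2 / (4 * v)) + -(1 / (2 * (2 * v))) * ‖x‖ ^ 2) := by
      unfold isoGaussianDensity
      rw [hκ, e, exp_add]
      linear_combination (exp (-(ε ^ 2 / (4 * v)))
        * (2 * π * v) ^ (-(Module.finrank ℝ H / 2 : ℝ))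
        * exp (-(1 / (2 * (2 * v))) * ‖x‖ ^ 2)) * e2
    rw [e3]
    unfold isoGaussianDensity
    gcongr
    have : ε ^ 2 / (4 * v) ≤ ‖x‖ ^ 2 / (4 * v) := by gcongr
    have e4 : -(1 / (2 * v)) * ‖x‖ ^ 2 = -(‖x‖ ^ 2 / (4 * v)) - ‖x‖ ^ 2 / (4 * v) := by
      field_simp; ring
    have e5 : -(1 / (2 * (2 * v))) * ‖x‖ ^ 2 = - (‖x‖ ^ 2 / (4 * v)) := by
      field_simp; ring
    rw [e4, e5]; linarith
  have hm : MeasurableSet (Metric.closedBall (0 : H) ε)ᶜ := Metric.isClosed_closedBall.measurableSet.compl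
  calc isoGaussian H v (Metric.closedBall 0 ε)ᶜ
      = ∫⁻ x in (Metric.closedBall (0 : H) ε)ᶜ, ENNReal.ofReal (isoGaussianDensity H v x) :=
        withDensity_apply _ hm
    _ ≤ ∫⁻ x in (Metric.closedBall (0 : H) ε)ᶜ,
          ENNReal.ofReal κ * ENNReal.ofReal (isoGaussianDensity H (2 * v) x) := by
        refine setLIntegral_mono' hm fun x hx => ?_
        rw [← ENNReal.ofReal_mul hκ0]
        exact ENNReal.ofReal_le_ofReal (hpt x hx)
    _ = ENNReal.ofReal κ * isoGaussian H (2 * v) (Metric.closedBall 0 ε)ᶜ := by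
        rw [lintegral_const_mul _ (continuous_isoGaussianDensity _).measurable.ennreal_ofReal,
          isoGaussian, withDensity_apply _ hm]
    _ ≤ ENNReal.ofReal κ * 1 := by gcongr; exact prob_le_one
    _ = _ := mul_one _

lemma tendsto_isoGaussian_closedBall {ε : ℝ} (hε : 0 < ε) :
    Tendsto (fun T : ℝ => isoGaussian H (1 / T) (Metric.closedBall 0 ε)) atTop (𝓝 1) := by
  have hlim : Tendsto (fun T : ℝ => 1 - ENNReal.ofReal
      (2 ^ (Module.finrank ℝ H / 2 : ℝ) * exp (-(ε ^ 2 / (4 * (1 / T)))))) atTop (𝓝 1) := by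
    have h1 : Tendsto (fun T : ℝ => exp (-(ε ^ 2 / (4 * (1 / T))))) atTop (𝓝 0) := by
      refine tendsto_exp_neg_atTop_nhds_zero.comp ?_
      have : (fun T : ℝ => ε ^ 2 / (4 * (1 / T))) = fun T => ε ^ 2 / 4 * T := by
        ext T; rw [mul_one_div, div_div_eq_mul_div, mul_div_right_comm]
      rw [this]
      exact tendsto_id.const_mul_atTop (by positivity)
    have h2 := ENNReal.tendsto_ofReal (h1.const_mul ((2 : ℝ) ^ (Module.finrank ℝ H / 2 : ℝ)))
    have h3 := ENNReal.Tendsto.sub (tendsto_const_nhds (x := (1 : ℝ≥0∞))) h2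
      (Or.inl ENNReal.one_ne_top)
    simpa using h3
  refine tendsto_of_tendsto_of_tendsto_of_le_of_le' hlim tendsto_const_nhds ?_ ?_
  · filter_upwards [eventually_gt_atTop 0] with T hT
    have := isProbabilityMeasure_isoGaussian (E := H) (one_div_pos.2 hT)
    rw [tsub_le_iff_right, ← measure_univ (μ := isoGaussian H (1 / T)),
      ← measure_add_measure_compl (Metric.isClosed_closedBall (x := (0 : H)) (ε := ε)).measurableSet]
    gcongr
    exact isoGaussian_compl_closedBall_le (one_div_pos.2 hT) hε.le
  · filter_upwards [eventually_gt_atTop 0] with T hT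
    have := isProbabilityMeasure_isoGaussian (E := H) (one_div_pos.2 hT)
    exact prob_le_one

variable {J : Type*} [Fintype J]

lemma norm_sum_sq_le_of_frame {B : J → H →ₗᵢ[ℝ] E} {A : J → E → H} {c : ℝ} (hc : 0 < c)
    (hadj : ∀ j z x, inner ℝ (B j z) x = inner ℝ z (A j x))
    (hA : ∀ x, c * ∑ j, ‖A j x‖ ^ 2 = ‖x‖ ^ 2) (m : J → E)
    (hm : ∀ j, m j ∈ LinearMap.range (B j).toLinearMap) :
    ‖∑ j, c • m j‖ ^ 2 ≤ c * ∑ j, ‖m j‖ ^ 2 := by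
  choose u hu using hm
  replace hu : ∀ j, m j = B j (u j) := fun j => (hu j).symm
  set a := ∑ j, c • m j with ha
  have h1 : ‖a‖ ^ 2 = c * ∑ j, inner ℝ (u j) (A j a) := by
    rw [← real_inner_self_eq_norm_sq]
    nth_rewrite 1 [ha]
    rw [sum_inner, Finset.mul_sum]
    refine Finset.sum_congr rfl fun j _ => ?_
    rw [inner_smul_left, hu, hadj]; simp
  have h2 : ∑ j, inner ℝ (u j) (A j a) ≤ ∑ j, (‖m j‖ ^ 2 + ‖A j a‖ ^ 2) / 2 := by
    refine Finset.sum_le_sum fun j _ => ?_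
    rw [hu, LinearIsometry.norm_map]
    nlinarith [real_inner_le_norm (u j) (A j a), sq_nonneg (‖u j‖ - ‖A j a‖)]
  have h3 : c * ∑ j, inner ℝ (u j) (A j a) ≤ c * ∑ j, (‖m j‖ ^ 2 + ‖A j a‖ ^ 2) / 2 := by gcongr
  rw [← Finset.sum_div, Finset.sum_add_distrib] at h3
  have := hA a
  nlinarith

lemma le_gaussLaplace_map (B : H →ₗᵢ[ℝ] E) {C : Set H} {T ε : ℝ} (hT : 0 < T) {x : E} {y : H}
    (hxy : ∀ z, inner ℝ (B z) x = inner ℝ z y) (hC : Metric.closedBall y ε ⊆ C) :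
    ENNReal.ofReal ((2 * π / T) ^ (Module.finrank ℝ H / 2 : ℝ) * exp (T * ‖y‖ ^ 2 / 2))
        * isoGaussian H (1 / T) (Metric.closedBall 0 ε)
      ≤ gaussLaplace ((volume.restrict C).map B) T (T • x) := by
  have hm : MeasurableSet (Metric.closedBall (0 : H) ε) := Metric.isClosed_closedBall.measurableSet
  have hpre : Metric.closedBall (0 : H) ε = (fun z => z + y) ⁻¹' Metric.closedBall y ε := by
    ext z; simp [dist_eq_norm]
  have hmp : MeasurePreserving (fun z : H => z + y)
      (volume.restrict (Metric.closedBall 0 ε)) (volume.restrict (Metric.closedBall y ε)) := by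
    rw [hpre]
    exact (measurePreserving_add_right volume y).restrict_preimage
      Metric.isClosed_closedBall.measurableSet
  unfold gaussLaplace
  rw [lintegral_map (by fun_prop) B.continuous.measurable]
  refine le_trans (le_of_eq ?_) (lintegral_mono' (Measure.restrict_mono hC le_rfl) le_rfl)
  rw [← hmp.lintegral_comp (by fun_prop), isoGaussian, withDensity_apply _ hm,
    ← lintegral_const_mul _ (continuous_isoGaussianDensity _).measurable.ennreal_ofReal]
  refine lintegral_congr fun z => ?_
  rw [← ENNReal.ofReal_mul (by positivity)]
  congr 1
  have e1 : inner ℝ (T • x) (B (z + y)) - T * ‖B (z + y)‖ ^ 2 / 2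
      = T * ‖y‖ ^ 2 / 2 + (-(1 / (2 * (1 / T))) * ‖z‖ ^ 2) := by
    rw [inner_smul_left, real_inner_comm, hxy, LinearIsometry.norm_map, norm_add_sq_real,
      inner_add_left, real_inner_self_eq_norm_sq]
    simp only [conj_trivial]
    field_simp; ring
  have e2 : (2 * π / T) ^ (Module.finrank ℝ H / 2 : ℝ)
      * (2 * π * (1 / T)) ^ (-(Module.finrank ℝ H / 2 : ℝ)) = 1 := by
    rw [mul_one_div, ← Real.rpow_add (by positivity)]; simp
  rw [e1, exp_add]
  unfold isoGaussianDensity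
  linear_combination (exp (T * ‖y‖ ^ 2 / 2) * exp (-(1 / (2 * (1 / T))) * ‖z‖ ^ 2)) * e2

lemma volume_mul_rpow_le {B : J → H →ₗᵢ[ℝ] E} {A : J → E → H} {c : ℝ} (hc : 0 < c)
    (hadj : ∀ j z x, inner ℝ (B j z) x = inner ℝ z (A j x))
    (hA : ∀ x, c * ∑ j, ‖A j x‖ ^ 2 = ‖x‖ ^ 2)
    (hdim : c * Fintype.card J * Module.finrank ℝ H = Module.finrank ℝ E)
    {K : Set E} (hK : IsCompact K) {C C' : Set H} (hC' : IsCompact C') {ε : ℝ}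
    (hCC' : ∀ y ∈ C, Metric.closedBall y ε ⊆ C') (hKC : ∀ j, ∀ x ∈ K, A j x ∈ C)
    {T : ℝ} (hT : 0 < T) :
    volume K * isoGaussian H (1 / T) (Metric.closedBall 0 ε) ^ (c * Fintype.card J)
      ≤ volume C' ^ (c * Fintype.card J) := by
  set p := c * Fintype.card J with hp
  have hp0 : 0 ≤ p := by positivity
  set q := isoGaussian H (1 / T) (Metric.closedBall 0 ε) with hq
  obtain ⟨R, hR0, hR⟩ : ∃ R, 0 ≤ R ∧ ∀ z ∈ C', ‖z‖ ≤ R := by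
    obtain ⟨R, hR⟩ := hC'.isBounded.exists_norm_le
    exact ⟨max R 0, le_max_right _ _, fun z hz => (hR z hz).trans (le_max_left _ _)⟩
  set ρ : J → Measure E := fun j => (volume.restrict C').map (B j) with hρ
  have hBm : ∀ j, Measurable (B j) := fun j => (B j).continuous.measurable
  have : IsFiniteMeasure (volume.restrict C') := ⟨by simpa using hC'.measure_lt_top⟩
  have hρfin : ∀ j, IsFiniteMeasure (ρ j) := fun j => Measure.isFiniteMeasure_map _ _
  have hρR : ∀ j, ∀ᵐ z ∂ρ j, ‖z‖ ≤ R := by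
    intro j
    rw [ae_map_iff (hBm j).aemeasurable (measurableSet_le measurable_norm measurable_const)]
    filter_upwards [ae_restrict_mem hC'.measurableSet] with z hz
    rw [LinearIsometry.norm_map]; exact hR z hz
  have hρF : ∀ j, ∀ᵐ z ∂ρ j, z ∈ LinearMap.range (B j).toLinearMap := by
    intro j
    exact (ae_map_iff (hBm j).aemeasurable (p := fun z => z ∈ LinearMap.range (B j).toLinearMap)
      (Submodule.closed_of_finiteDimensional (LinearMap.range (B j).toLinearMap)).measurableSet).2
      (ae_of_all _ fun z => ⟨z, rfl⟩)
  have hρuniv : ∀ j, ρ j univ = volume C' := fun j => by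
    rw [hρ, Measure.map_apply (hBm j) MeasurableSet.univ]; simp
  have key := lintegral_prod_gaussLaplace_le ρ hR0 hρR hρF hc
    (norm_sum_sq_le_of_frame hc hadj hA) hT
  simp_rw [hρuniv] at key
  rw [Finset.prod_const, Finset.card_univ, ← ENNReal.rpow_mul_natCast, ← hp] at key
  refine le_trans ?_ key
  rw [lintegral_isoGaussian (Finset.measurable_prod _ fun j _ =>
    (measurable_gaussLaplace (ρ j) T).pow_const c)]
  set s := (2 * π / T) ^ (Module.finrank ℝ H / 2 : ℝ) with hs
  have hs0 : 0 < s := by positivity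
  have hTK : MeasurableSet (T • K) := (hK.smul T).measurableSet
  set b := (2 * π * T) ^ (-(Module.finrank ℝ E / 2 : ℝ)) * s ^ p with hb
  have hb0 : 0 ≤ b := by positivity
  have hbT : b * T ^ Module.finrank ℝ E = 1 := by
    rw [hb, hs, ← Real.rpow_mul (by positivity)]
    have e1 : (Module.finrank ℝ H / 2 : ℝ) * p = Module.finrank ℝ E / 2 := by
      rw [← hdim]; ring
    have e2 : T ^ Module.finrank ℝ E = (T * T) ^ (Module.finrank ℝ E / 2 : ℝ) := by
      rw [← pow_two, ← Real.rpow_natCast T 2, ← Real.rpow_mul hT.le, ← Real.rpow_natCast]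
      congr 1; push_cast; ring
    rw [e1, e2, Real.rpow_neg (by positivity), ← Real.inv_rpow (by positivity),
      ← Real.mul_rpow (by positivity) (by positivity),
      ← Real.mul_rpow (by positivity) (by positivity)]
    have : (2 * π * T)⁻¹ * (2 * π / T) * (T * T) = 1 := by field_simp
    rw [this, Real.one_rpow]
  have hlow : ∀ x ∈ T • K, ENNReal.ofReal b * q ^ p
      ≤ ENNReal.ofReal (isoGaussianDensity E T x) * ∏ j, gaussLaplace (ρ j) T x ^ c := by
    intro x hx
    obtain ⟨y, hy, rfl⟩ := Set.mem_smul_set.1 hx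
    have h1 : ∀ j, ENNReal.ofReal (s * exp (T * ‖A j y‖ ^ 2 / 2)) * q
        ≤ gaussLaplace (ρ j) T (T • y) := fun j =>
      le_gaussLaplace_map (B j) hT (fun z => hadj j z y) (hCC' _ (hKC j y hy))
    have h2 : ∏ j, (ENNReal.ofReal (s * exp (T * ‖A j y‖ ^ 2 / 2)) * q) ^ c
        = ENNReal.ofReal (s ^ p * exp (T * ‖y‖ ^ 2 / 2)) * q ^ p := by
      have h3 : ∀ j, (ENNReal.ofReal (s * exp (T * ‖A j y‖ ^ 2 / 2)) * q) ^ c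
          = ENNReal.ofReal (s ^ c * exp (T * ‖A j y‖ ^ 2 / 2 * c)) * q ^ c := by
        intro j
        rw [ENNReal.mul_rpow_of_nonneg _ _ hc.le,
          ENNReal.ofReal_rpow_of_nonneg (by positivity) hc.le,
          Real.mul_rpow hs0.le (exp_pos _).le, ← Real.exp_mul]
      simp_rw [h3]
      rw [Finset.prod_mul_distrib, Finset.prod_const, Finset.card_univ,
        ← ENNReal.rpow_mul_natCast, ← hp,
        ← ENNReal.ofReal_prod_of_nonneg fun j _ => by positivity, Finset.prod_mul_distrib,
        Finset.prod_const, Finset.card_univ, ← Real.rpow_mul_natCast hs0.le, ← hp, ← exp_sum,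
        ← hA y]
      congr 4
      rw [Finset.mul_sum, Finset.mul_sum, Finset.sum_div]
      exact Finset.sum_congr rfl fun j _ => by ring
    calc ENNReal.ofReal b * q ^ p
        = ENNReal.ofReal (isoGaussianDensity E T (T • y))
          * (ENNReal.ofReal (s ^ p * exp (T * ‖y‖ ^ 2 / 2)) * q ^ p) := by
          rw [← mul_assoc, ← ENNReal.ofReal_mul (isoGaussianDensity_pos hT _).le]
          congr 2
          have : exp (-(1 / (2 * T)) * ‖T • y‖ ^ 2) * exp (T * ‖y‖ ^ 2 / 2) = 1 := by
            rw [← exp_add, norm_smul, mul_pow, Real.norm_eq_abs, sq_abs, exp_eq_one_iff]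
            field_simp; ring
          unfold isoGaussianDensity
          rw [hb]
          linear_combination (-(2 * π * T) ^ (-(Module.finrank ℝ E / 2 : ℝ)) * s ^ p) * this
      _ ≤ _ := by
          rw [← h2]
          gcongr with j
          exact h1 j
  calc volume K * q ^ p = ∫⁻ _x in T • K, ENNReal.ofReal b * q ^ p := by
        rw [setLIntegral_const, Measure.addHaar_smul, abs_of_pos (by positivity)]
        rw [mul_comm (volume K), mul_mul_mul_comm, ← mul_assoc, mul_comm _ (q ^ p), mul_assoc (q ^ p),
          ← ENNReal.ofReal_mul hb0, hbT, ENNReal.ofReal_one, one_mul, mul_comm]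
    _ ≤ ∫⁻ x in T • K,
        ENNReal.ofReal (isoGaussianDensity E T x) * ∏ j, gaussLaplace (ρ j) T x ^ c :=
        setLIntegral_mono' hTK hlow
    _ ≤ _ := setLIntegral_le_lintegral _ _

/-- Geometric Brascamp–Lieb inequality for indicator functions of compact sets. -/
theorem volume_le_volume_rpow_of_frame {B : J → H →ₗᵢ[ℝ] E} {A : J → E → H} {c : ℝ} (hc : 0 < c)
    (hadj : ∀ j z x, inner ℝ (B j z) x = inner ℝ z (A j x))
    (hA : ∀ x, c * ∑ j, ‖A j x‖ ^ 2 = ‖x‖ ^ 2)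
    (hdim : c * Fintype.card J * Module.finrank ℝ H = Module.finrank ℝ E)
    {K : Set E} (hK : IsCompact K) {C : Set H} (hC : IsCompact C)
    (hKC : ∀ j, ∀ x ∈ K, A j x ∈ C) :
    volume K ≤ volume C ^ (c * Fintype.card J) := by
  have h1 : ∀ ε > 0, volume K ≤ volume (Metric.cthickening ε C) ^ (c * Fintype.card J) := by
    intro ε hε
    have hlim : Tendsto (fun T : ℝ => volume K *
        isoGaussian H (1 / T) (Metric.closedBall 0 ε) ^ (c * Fintype.card J)) atTop
        (𝓝 (volume K * 1 ^ (c * Fintype.card J))) :=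
      ENNReal.Tendsto.const_mul
        ((ENNReal.continuous_rpow_const.tendsto 1).comp (tendsto_isoGaussian_closedBall hε))
        (Or.inl (by simp))
    rw [ENNReal.one_rpow, mul_one] at hlim
    refine le_of_tendsto hlim ?_
    filter_upwards [eventually_gt_atTop 0] with T hT
    exact volume_mul_rpow_le hc hadj hA hdim hK hC.cthickening
      (fun y hy => Metric.closedBall_subset_cthickening hy ε) hKC hT
  have h2 : Tendsto (fun ε => volume (Metric.cthickening ε C) ^ (c * Fintype.card J)) (𝓝[>] 0)
      (𝓝 (volume C ^ (c * Fintype.card J))) :=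
    ((ENNReal.continuous_rpow_const.tendsto _).comp
      (tendsto_measure_cthickening_of_isCompact hC)).mono_left nhdsWithin_le_nhds
  exact ge_of_tendsto h2 (eventually_nhdsWithin_of_forall h1)

end Volume

end

section Frame

variable {ι : Type*} [Fintype ι] [DecidableEq ι]

lemma sum_signs_mul_eq_zero {a b : ι} (hab : a ≠ b) :
    ∑ ε : ι → ℤˣ, ((ε a : ℤ) : ℝ) * ((ε b : ℤ) : ℝ) = 0 := by
  have h := Equiv.sum_comp (Equiv.mulRight (Pi.mulSingle a (-1) : ι → ℤˣ))
    fun ε : ι → ℤˣ => ((ε a : ℤ) : ℝ) * ((ε b : ℤ) : ℝ)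
  simp only [Equiv.coe_mulRight, Pi.mul_apply, Pi.mulSingle_eq_same,
    Pi.mulSingle_eq_of_ne hab.symm, mul_one, Units.val_neg,
    mul_neg, Int.cast_neg, neg_mul, Finset.sum_neg_distrib] at h
  linarith

lemma intUnit_cast_mul_self (e : ℤˣ) : ((e : ℤ) : ℝ) * ((e : ℤ) : ℝ) = 1 := by
  rcases Int.units_eq_one_or e with rfl | rfl <;> simp

lemma sum_signs_sq (w : ι → ℝ) :
    ∑ ε : ι → ℤˣ, (∑ j, ((ε j : ℤ) : ℝ) * w j) ^ 2
      = Fintype.card (ι → ℤˣ) * ∑ j, w j ^ 2 := by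
  have h : ∀ a b : ι, ∑ ε : ι → ℤˣ, (((ε a : ℤ) : ℝ) * w a) * (((ε b : ℤ) : ℝ) * w b)
      = if a = b then Fintype.card (ι → ℤˣ) * w a ^ 2 else 0 := by
    intro a b
    have e : ∀ ε : ι → ℤˣ, (((ε a : ℤ) : ℝ) * w a) * (((ε b : ℤ) : ℝ) * w b)
        = (((ε a : ℤ) : ℝ) * ((ε b : ℤ) : ℝ)) * (w a * w b) := fun ε => by ring
    simp_rw [e]
    rw [← Finset.sum_mul]
    split_ifs with hab
    · subst hab
      simp_rw [intUnit_cast_mul_self]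
      rw [Finset.sum_const, Finset.card_univ, nsmul_eq_mul, mul_one, sq]
    · rw [sum_signs_mul_eq_zero hab, zero_mul]
  simp_rw [sq (∑ j, _), Finset.sum_mul_sum]
  rw [Finset.sum_comm, Finset.mul_sum]
  refine Finset.sum_congr rfl fun a _ => ?_
  rw [Finset.sum_comm]
  simp_rw [h]
  simp

lemma card_mul_sum_perm_apply (v : ι → ℝ) (j : ι) :
    (Fintype.card ι : ℝ) * ∑ σ : Equiv.Perm ι, v (σ j)
      = Fintype.card (Equiv.Perm ι) * ∑ i, v i := by
  have h : ∀ i, ∑ σ : Equiv.Perm ι, v (σ i) = ∑ σ : Equiv.Perm ι, v (σ j) := by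
    intro i
    rw [← Equiv.sum_comp (Equiv.mulRight (Equiv.swap i j)) fun σ : Equiv.Perm ι => v (σ i)]
    simp
  calc (Fintype.card ι : ℝ) * ∑ σ : Equiv.Perm ι, v (σ j)
      = ∑ i, ∑ σ : Equiv.Perm ι, v (σ i) := by simp [h]
    _ = ∑ σ : Equiv.Perm ι, ∑ i, v i := by
        rw [Finset.sum_comm]
        exact Finset.sum_congr rfl fun σ _ => Equiv.sum_comp σ v
    _ = _ := by simp

/-- The hyperoctahedral orbit of any vector `u` is a tight frame. -/
lemma sum_signedPerm_sq (u x : ι → ℝ) :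
    (Fintype.card ι : ℝ) * ∑ g : (ι → ℤˣ) × Equiv.Perm ι,
        (∑ j, ((g.1 j : ℤ) : ℝ) * (x j * u (g.2 j))) ^ 2
      = Fintype.card ((ι → ℤˣ) × Equiv.Perm ι) * ((∑ j, x j ^ 2) * ∑ j, u j ^ 2) := by
  have h : ∀ σ : Equiv.Perm ι, ∑ ε : ι → ℤˣ, (∑ j, ((ε j : ℤ) : ℝ) * (x j * u (σ j))) ^ 2
      = Fintype.card (ι → ℤˣ) * ∑ j, x j ^ 2 * u (σ j) ^ 2 := fun σ => by
    simp_rw [sum_signs_sq, mul_pow]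
  rw [Fintype.sum_prod_type_right]
  simp_rw [h]
  rw [← Finset.mul_sum, Finset.sum_comm, mul_left_comm, Finset.mul_sum]
  have h2 : ∀ j, (Fintype.card ι : ℝ) * ∑ σ : Equiv.Perm ι, x j ^ 2 * u (σ j) ^ 2
      = x j ^ 2 * (Fintype.card (Equiv.Perm ι) * ∑ i, u i ^ 2) := fun j => by
    rw [← Finset.mul_sum, mul_left_comm, card_mul_sum_perm_apply (fun i => u i ^ 2)]
  simp_rw [h2]
  rw [← Finset.sum_mul, Fintype.card_prod]
  push_cast
  ring

end Frame

section OneSymmetric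

variable {n d : ℕ}

lemma sum_mul_map_of_sum_sq {ι : (Fin d → ℝ) →ₗ[ℝ] (Fin n → ℝ)}
    (hι : ∀ y, ∑ c, ι y c ^ 2 = ∑ i, y i ^ 2) (y z : Fin d → ℝ) :
    ∑ c, ι y c * ι z c = ∑ i, y i * z i := by
  have h := hι (y + z)
  simp only [map_add, Pi.add_apply, add_sq, Finset.sum_add_distrib, hι y, hι z, mul_assoc,
    ← Finset.mul_sum] at h
  linarith

/-- The transpose of a linear map between coordinate spaces. -/
def coordAdjoint (ι : (Fin d → ℝ) →ₗ[ℝ] (Fin n → ℝ)) (x : Fin n → ℝ) : Fin d → ℝ :=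
  fun i => ∑ c, x c * ι (Pi.single i 1) c

lemma continuous_coordAdjoint (ι : (Fin d → ℝ) →ₗ[ℝ] (Fin n → ℝ)) :
    Continuous (coordAdjoint ι) := by
  unfold coordAdjoint
  fun_prop

lemma sum_map_mul (ι : (Fin d → ℝ) →ₗ[ℝ] (Fin n → ℝ)) (z : Fin d → ℝ) (x : Fin n → ℝ) :
    ∑ c, ι z c * x c = ∑ i, z i * coordAdjoint ι x i := by
  have h : ι z = ∑ i, z i • ι (Pi.single i 1) := by
    conv_lhs => rw [pi_eq_sum_univ' z]
    simp [map_sum]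
  simp only [coordAdjoint, h, Finset.sum_apply, Pi.smul_apply, smul_eq_mul, Finset.sum_mul,
    Finset.mul_sum]
  rw [Finset.sum_comm]
  exact Finset.sum_congr rfl fun i _ => Finset.sum_congr rfl fun c _ => by ring

lemma coordAdjoint_map {ι : (Fin d → ℝ) →ₗ[ℝ] (Fin n → ℝ)}
    (hι : ∀ y, ∑ c, ι y c ^ 2 = ∑ i, y i ^ 2) (y : Fin d → ℝ) :
    coordAdjoint ι (ι y) = y := by
  ext i
  simp [coordAdjoint, sum_mul_map_of_sum_sq hι, Pi.single_apply]

/-- The composition of a Euclidean isometry with a signed coordinate permutation. -/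
def signedPermIsometry {ι : (Fin d → ℝ) →ₗ[ℝ] (Fin n → ℝ)}
    (hι : ∀ y, ∑ c, ι y c ^ 2 = ∑ i, y i ^ 2) (g : (Fin n → ℤˣ) × Equiv.Perm (Fin n)) :
    EuclideanSpace ℝ (Fin d) →ₗᵢ[ℝ] EuclideanSpace ℝ (Fin n) where
  toFun z := WithLp.toLp 2 fun j => ((g.1 j : ℤ) : ℝ) * ι z.ofLp (g.2 j)
  map_add' y z := by ext j; simp [mul_add]
  map_smul' r z := by ext j; simp [mul_left_comm]
  norm_map' z := by
    have e : ∀ j, (((g.1 j : ℤ) : ℝ) * ι z.ofLp (g.2 j)) ^ 2 = ι z.ofLp (g.2 j) ^ 2 := fun j => by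
      rw [mul_pow, sq, intUnit_cast_mul_self, one_mul]
    simp only [LinearMap.coe_mk, AddHom.coe_mk, EuclideanSpace.norm_eq, Real.norm_eq_abs, sq_abs, e]
    rw [Equiv.sum_comp g.2 fun c => ι z.ofLp c ^ 2, hι]

/-- The action of the inverse of a signed permutation on coordinate vectors. -/
def signedPermInv (g : (Fin n → ℤˣ) × Equiv.Perm (Fin n)) (x : Fin n → ℝ) : Fin n → ℝ :=
  fun c => ((g.1 (g.2.symm c) : ℤ) : ℝ) * x (g.2.symm c)

lemma sum_signedPermInv_mul (g : (Fin n → ℤˣ) × Equiv.Perm (Fin n)) (x u : Fin n → ℝ) :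
    ∑ c, signedPermInv g x c * u c = ∑ j, ((g.1 j : ℤ) : ℝ) * (x j * u (g.2 j)) := by
  rw [← Equiv.sum_comp g.2]
  simp [signedPermInv, mul_assoc]

lemma IsOneSymmetric.signedPermInv_mem {K : Set (Fin n → ℝ)} (hK : IsOneSymmetric n K)
    (g : (Fin n → ℤˣ) × Equiv.Perm (Fin n)) {x : Fin n → ℝ} (hx : x ∈ K) :
    signedPermInv g x ∈ K := by
  refine (hK (fun c => ((g.1 (g.2.symm c) : ℤ) : ℝ)) (fun c => ?_) g.2.symm x).1 hx
  rcases Int.units_eq_one_or (g.1 (g.2.symm c)) with h | h <;> simp [h]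

lemma IsOneSymmetric.volume_le_volume_coordAdjoint_image {K : Set (Fin n → ℝ)}
    (hK : IsOneSymmetric n K) (hKc : IsCompact K) (hd : d ≠ 0) (hn : n ≠ 0)
    {ι : (Fin d → ℝ) →ₗ[ℝ] (Fin n → ℝ)} (hι : ∀ y, ∑ c, ι y c ^ 2 = ∑ i, y i ^ 2) :
    volume K ≤ volume (coordAdjoint ι '' K) ^ ((n : ℝ) / d) := by
  have hd0 : (0 : ℝ) < d := by exact_mod_cast Nat.pos_of_ne_zero hd
  have hn0 : (0 : ℝ) < n := by exact_mod_cast Nat.pos_of_ne_zero hn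
  let J := (Fin n → ℤˣ) × Equiv.Perm (Fin n)
  have hJ : (0 : ℝ) < Fintype.card J := by exact_mod_cast Fintype.card_pos
  let A : J → EuclideanSpace ℝ (Fin n) → EuclideanSpace ℝ (Fin d) := fun g x =>
    WithLp.toLp 2 (coordAdjoint ι (signedPermInv g x.ofLp))
  have hcJ : (n : ℝ) / (d * Fintype.card J) * Fintype.card J = n / d := by field_simp
  have hunit : ∀ i : Fin d, ∑ c, ι (Pi.single i 1) c ^ 2 = 1 := fun i => by
    rw [hι]; simp [Pi.single_apply]
  have hadj : ∀ (g : J) z x, inner ℝ (signedPermIsometry hι g z) x = inner ℝ z (A g x) := by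
    intro g z x
    have h1 : inner ℝ z (A g x) = ∑ i, z i * coordAdjoint ι (signedPermInv g x.ofLp) i := by
      simp [PiLp.inner_apply, A, mul_comm]
    rw [h1, ← sum_map_mul]
    simp_rw [mul_comm (ι z.ofLp _)]
    rw [sum_signedPermInv_mul]
    simp [PiLp.inner_apply, signedPermIsometry, mul_left_comm]
  have hA : ∀ x, (n : ℝ) / (d * Fintype.card J) * ∑ g : J, ‖A g x‖ ^ 2 = ‖x‖ ^ 2 := by
    intro x
    have h1 : ∀ g : J, ‖A g x‖ ^ 2
        = ∑ i, (∑ j, ((g.1 j : ℤ) : ℝ) * (x j * ι (Pi.single i 1) (g.2 j))) ^ 2 := by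
      intro g
      rw [EuclideanSpace.norm_sq_eq]
      simp only [A, coordAdjoint, sum_signedPermInv_mul, Real.norm_eq_abs, sq_abs]
    have h2 : (n : ℝ) * ∑ g : J, ‖A g x‖ ^ 2 = d * (Fintype.card J * ‖x‖ ^ 2) := by
      simp_rw [h1]
      rw [Finset.sum_comm, Finset.mul_sum]
      have h3 : ∀ i : Fin d, (n : ℝ) * ∑ g : J,
          (∑ j, ((g.1 j : ℤ) : ℝ) * (x j * ι (Pi.single i 1) (g.2 j))) ^ 2
          = Fintype.card J * ‖x‖ ^ 2 := fun i => by
        have := sum_signedPerm_sq (ι (Pi.single i 1)) x.ofLp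
        rw [hunit, Fintype.card_fin, mul_one] at this
        rw [this, EuclideanSpace.norm_sq_eq]
        simp [J]
      simp_rw [h3]
      simp
    rw [div_mul_eq_mul_div, h2]
    field_simp
  have key := volume_le_volume_rpow_of_frame (B := signedPermIsometry hι) (A := A)
    (c := (n : ℝ) / (d * Fintype.card J)) (by positivity) hadj hA
    (by rw [hcJ]; simp; field_simp)
    (K := WithLp.toLp 2 '' K) (hKc.image (PiLp.continuous_toLp 2 _))
    (C := WithLp.toLp 2 '' (coordAdjoint ι '' K))
    ((hKc.image (continuous_coordAdjoint ι)).image (PiLp.continuous_toLp 2 _))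
    (by
      rintro g _ ⟨x, hx, rfl⟩
      exact ⟨_, ⟨_, hK.signedPermInv_mem g hx, rfl⟩, rfl⟩)
  have hvol : ∀ (m : ℕ) (S : Set (Fin m → ℝ)),
      volume (WithLp.toLp 2 '' S : Set (EuclideanSpace ℝ (Fin m))) = volume S := by
    intro m S
    have h := (EuclideanSpace.volume_preserving_symm_measurableEquiv_toLp (Fin m)).measure_preimage_equiv S
    rw [← h]
    congr 1
    exact Equiv.image_eq_preimage_symm (WithLp.equiv 2 (Fin m → ℝ)).symm S
  rwa [hvol, hvol, hcJ] at key

end OneSymmetric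

/-- **Proposition (projections of 1-symmetric bodies).** Fix `d ∈ {1,…,n}`. For every
1-symmetric convex body `K ⊆ ℝ^n` and every `d`-dimensional subspace `F` of `ℝ^n`,
`|Proj_F K| ≥ |K|^{d/n}`. Here `P` is the orthogonal projection onto `F` (characterized by
`P x ∈ F` and `x − P x ⟂ F`), and the `d`-dimensional Lebesgue measure of the projection is
computed via a Euclidean isometric parametrization `ι` of `F`. -/
theorem proj_one_symmetric_lower_bound (n d : ℕ) (hd1 : 1 ≤ d) (hdn : d ≤ n)
    (K : Set (Fin n → ℝ)) (hKcpt : IsCompact K) (hKconv : Convex ℝ K)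
    (hKint : (interior K).Nonempty) (hKsym : IsOneSymmetric n K)
    (F : Submodule ℝ (Fin n → ℝ)) (hF : Module.finrank ℝ F = d)
    (P : (Fin n → ℝ) →ₗ[ℝ] (Fin n → ℝ))
    (hP1 : ∀ x, P x ∈ F)
    (hP2 : ∀ x, ∀ h ∈ F, ∑ c, (x c - P x c) * h c = 0)
    (ι : (Fin d → ℝ) →ₗ[ℝ] (Fin n → ℝ))
    (hιn : ∀ y, ∑ c, ι y c ^ 2 = ∑ i, y i ^ 2)
    (hιr : Set.range ⇑ι = (F : Set (Fin n → ℝ))) :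
    volume K ^ ((d : ℝ) / (n : ℝ)) ≤ volume (⇑ι ⁻¹' (⇑P '' K)) := by
  have hd0 : d ≠ 0 := by omega
  have hn0 : n ≠ 0 := by omega
  have hmem : ∀ y, ι y ∈ F := fun y => by
    rw [← SetLike.mem_coe, ← hιr]; exact Set.mem_range_self y
  have hPx : ∀ x, coordAdjoint ι (P x) = coordAdjoint ι x := by
    intro x
    ext i
    have := hP2 x _ (hmem (Pi.single i 1))
    simp only [sub_mul, Finset.sum_sub_distrib] at this
    simp only [coordAdjoint]
    linarith
  have hpre : ⇑ι ⁻¹' (⇑P '' K) = coordAdjoint ι '' K := by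
    ext y
    constructor
    · rintro ⟨x, hx, hxy⟩
      exact ⟨x, hx, by rw [← hPx, hxy, coordAdjoint_map hιn]⟩
    · rintro ⟨x, hx, rfl⟩
      obtain ⟨y, hy⟩ : P x ∈ Set.range ι := by rw [hιr]; exact hP1 x
      refine ⟨x, hx, ?_⟩
      rw [← hPx, ← hy, coordAdjoint_map hιn]
  rw [hpre]
  have h := ENNReal.rpow_le_rpow (hKsym.volume_le_volume_coordAdjoint_image hKcpt hd0 hn0 hιn)
    (by positivity : 0 ≤ (d : ℝ) / n)
  have e : (n : ℝ) / d * (d / n) = 1 := by field_simp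
  rwa [← ENNReal.rpow_mul, e, ENNReal.rpow_one] at h
end
end
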